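/- Let α₁,…,αₙ (n ≥ 1) be pairwise linearly independent nonzero complex linear forms on ℂ², so that M = {z ∈ ℂ² : ∏ᵢ αᵢ(z) ≠ 0} is the complement of n distinct lines through the origin in ℂ². Then the Betti numbers of M are b₀(M) = 1, b₁(M) = n, and b₂(M) = n − 1; that is, the Poincaré polynomial of M is (1 + t)(1 + (n−1)t). -/

import Mathlib

open CategoryTheory

/-- The singular chain complex of a topological space with `ℤ` coefficients: the alternating
face map complex of the free simplicial `ℤ`-module on the singular simplicial set. -/
noncomputable def singularChainComplex (X : TopCat.{0}) : ChainComplex (ModuleCat.{0} ℤ) ℕ :=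
  (AlgebraicTopology.alternatingFaceMapComplex (ModuleCat.{0} ℤ)).obj
    (((CategoryTheory.SimplicialObject.whiskering (Type 0) (ModuleCat.{0} ℤ)).obj
        (ModuleCat.free ℤ)).obj (TopCat.toSSet.obj X))

/-- The `p`-th singular homology of a topological space with `ℤ` coefficients. -/
noncomputable def singularHomology (X : TopCat.{0}) (p : ℕ) : ModuleCat.{0} ℤ :=
  (singularChainComplex X).homology p

/-- The `p`-th Betti number of a topological space: the rank of `H_p(X; ℤ)`. -/
noncomputable def bettiNumber (X : TopCat.{0}) (p : ℕ) : Cardinal :=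
  Module.rank ℤ (singularHomology X p)

namespace TupleChain

/-- Integral chains on `n`-tuples of elements of `K`. -/
abbrev _root_.TupleChain (K : Type) (n : ℕ) : Type := (Fin n → K) →₀ ℤ

variable {K L : Type}

/-- The alternating sum of the faces of a tuple. -/
noncomputable def boundary (K : Type) (n : ℕ) : TupleChain K (n + 1) →ₗ[ℤ] TupleChain K n :=
  Finsupp.linearCombination ℤ
    fun v ↦ ∑ i : Fin (n + 1), (-1 : ℤ) ^ (i : ℕ) • Finsupp.single (v ∘ i.succAbove) 1

/-- The cone with apex `b`. -/
noncomputable def cone (b : K) (n : ℕ) : TupleChain K n →ₗ[ℤ] TupleChain K (n + 1) :=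
  Finsupp.lmapDomain ℤ ℤ (fun v ↦ (Fin.cons b v : Fin (n + 1) → K))

lemma boundary_single {n : ℕ} (v : Fin (n + 1) → K) :
    boundary K n (Finsupp.single v 1) =
      ∑ i : Fin (n + 1), (-1 : ℤ) ^ (i : ℕ) • Finsupp.single (v ∘ i.succAbove) 1 := by
  simp [boundary]

lemma cone_single (b : K) {n : ℕ} (v : Fin n → K) (z : ℤ) :
    cone b n (Finsupp.single v z) = Finsupp.single (Fin.cons b v : Fin (n + 1) → K) z := by
  simp [cone]

lemma boundary_cone_zero (b : K) (c : TupleChain K 0) : boundary K 0 (cone b 0 c) = c := by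
  suffices boundary K 0 ∘ₗ cone b 0 = LinearMap.id from LinearMap.congr_fun this c
  ext1 v
  ext1
  simp only [LinearMap.comp_apply, Finsupp.lsingle_apply, cone_single, boundary_single]
  simp [Subsingleton.elim _ v]

lemma boundary_cone (b : K) {n : ℕ} (c : TupleChain K (n + 1)) :
    boundary K (n + 1) (cone b (n + 1) c) = c - cone b n (boundary K n c) := by
  suffices boundary K (n + 1) ∘ₗ cone b (n + 1) = LinearMap.id - cone b n ∘ₗ boundary K n from
    LinearMap.congr_fun this c
  ext1 v
  ext1
  simp only [LinearMap.comp_apply, Finsupp.lsingle_apply, cone_single, boundary_single,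
    LinearMap.sub_apply, LinearMap.id_apply, map_sum, map_smul]
  rw [Fin.sum_univ_succ, sub_eq_add_neg, ← Finset.sum_neg_distrib]
  congr 1
  · simp
  · refine Finset.sum_congr rfl fun i _ ↦ ?_
    have : (Fin.cons b v : Fin (n + 2) → K) ∘ i.succ.succAbove =
        (Fin.cons b (v ∘ i.succAbove) : Fin (n + 1) → K) := by
      ext j
      refine Fin.cases ?_ (fun j ↦ ?_) j <;> simp
    rw [this, Fin.val_succ, pow_succ]
    simp

lemma boundary_boundary {n : ℕ} (c : TupleChain K (n + 2)) :
    boundary K n (boundary K (n + 1) c) = 0 := by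
  suffices boundary K n ∘ₗ boundary K (n + 1) = 0 from LinearMap.congr_fun this c
  ext1 v
  ext1
  simp only [LinearMap.comp_apply, Finsupp.lsingle_apply, LinearMap.zero_apply]
  rw [← Fin.cons_self_tail v, ← cone_single, boundary_cone, map_sub]
  cases n with
  | zero => rw [boundary_cone_zero, sub_self]
  | succ n => rw [boundary_cone, boundary_boundary]; simp

/-- The map of chains induced by a map of sets. -/
noncomputable def map (f : K → L) (n : ℕ) : TupleChain K n →ₗ[ℤ] TupleChain L n :=
  Finsupp.lmapDomain ℤ ℤ (f ∘ ·)

lemma map_single (f : K → L) {n : ℕ} (v : Fin n → K) (z : ℤ) :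
    map f n (Finsupp.single v z) = Finsupp.single (f ∘ v) z := by
  simp [map]

lemma map_boundary (f : K → L) {n : ℕ} (c : TupleChain K (n + 1)) :
    map f n (boundary K n c) = boundary L n (map f (n + 1) c) := by
  suffices map f n ∘ₗ boundary K n = boundary L n ∘ₗ map f (n + 1) from LinearMap.congr_fun this c
  ext1 v
  ext1
  simp [map_single, boundary_single, Function.comp_assoc]

lemma map_cone (f : K → L) (b : K) {n : ℕ} (c : TupleChain K n) :
    map f (n + 1) (cone b n c) = cone (f b) n (map f n c) := by
  suffices map f (n + 1) ∘ₗ cone b n = cone (f b) n ∘ₗ map f n from LinearMap.congr_fun this c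
  ext1 v
  ext1
  simp only [LinearMap.comp_apply, Finsupp.lsingle_apply, cone_single, map_single]
  congr 1
  ext j
  refine Fin.cases ?_ (fun j ↦ ?_) j <;> simp

section Subdivision

variable (b : ∀ n, (Fin (n + 1) → K) → K) (b' : ∀ n, (Fin (n + 1) → L) → L)

/-- The homotopy between the identity and the subdivision attached to a choice `b` of a centre
for every tuple. -/
noncomputable def homotopy : ∀ n, TupleChain K n →ₗ[ℤ] TupleChain K (n + 1)
  | 0 => 0
  | n + 1 => Finsupp.linearCombination ℤ fun v ↦ cone (b n v) (n + 1)
      (Finsupp.single v 1 - homotopy n (boundary K n (Finsupp.single v 1)))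

/-- The subdivision attached to a choice `b` of a centre for every tuple. -/
noncomputable def subdivision : ∀ n, TupleChain K n →ₗ[ℤ] TupleChain K n
  | 0 => LinearMap.id
  | n + 1 => LinearMap.id - boundary K (n + 1) ∘ₗ homotopy b (n + 1) - homotopy b n ∘ₗ boundary K n

lemma homotopy_single {n : ℕ} (v : Fin (n + 1) → K) :
    homotopy b (n + 1) (Finsupp.single v 1) = cone (b n v) (n + 1)
      (Finsupp.single v 1 - homotopy b n (boundary K n (Finsupp.single v 1))) := by
  simp [homotopy]

lemma subdivision_single {n : ℕ} (v : Fin (n + 1) → K) :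
    subdivision b (n + 1) (Finsupp.single v 1) =
      cone (b n v) n (subdivision b n (boundary K n (Finsupp.single v 1))) := by
  simp only [subdivision, LinearMap.sub_apply, LinearMap.id_apply, LinearMap.comp_apply]
  rw [homotopy_single, boundary_cone, map_sub]
  cases n with
  | zero => simp [homotopy]
  | succ n =>
    simp only [LinearMap.sub_apply, LinearMap.id_apply, LinearMap.comp_apply,
      boundary_boundary, map_zero, sub_zero]
    abel

lemma map_homotopy {f : K → L} (hf : ∀ n v, f (b n v) = b' n (f ∘ v)) {n : ℕ}
    (c : TupleChain K n) :
    map f (n + 1) (homotopy b n c) = homotopy b' n (map f n c) := by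
  induction n with
  | zero => simp [homotopy]
  | succ n ih =>
    suffices map f (n + 2) ∘ₗ homotopy b (n + 1) = homotopy b' (n + 1) ∘ₗ map f (n + 1) from
      LinearMap.congr_fun this c
    ext1 v
    ext1
    simp only [LinearMap.comp_apply, Finsupp.lsingle_apply, map_single, homotopy_single, map_cone,
      hf, map_sub, ih, map_boundary]

/-- A chain is supported in `s` if its image under a linear map is, for every tuple. -/
lemma mem_supported_of_forall {ι κ : Type} {s : Set ι} {t : Set κ} {f : (ι →₀ ℤ) →ₗ[ℤ] (κ →₀ ℤ)}
    (h : ∀ v ∈ s, f (Finsupp.single v 1) ∈ Finsupp.supported ℤ ℤ t) {c : ι →₀ ℤ}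
    (hc : c ∈ Finsupp.supported ℤ ℤ s) : f c ∈ Finsupp.supported ℤ ℤ t := by
  rw [Finsupp.supported_eq_span_single] at hc
  have : Submodule.span ℤ ((fun i ↦ Finsupp.single i (1 : ℤ)) '' s) ≤
      (Finsupp.supported ℤ ℤ t).comap f := by
    rw [Submodule.span_le]
    rintro _ ⟨v, hv, rfl⟩
    exact h v hv
  exact this hc

lemma boundary_single_mem {n : ℕ} {s : Set (Fin n → K)} {v : Fin (n + 1) → K}
    (h : ∀ i : Fin (n + 1), v ∘ i.succAbove ∈ s) :
    boundary K n (Finsupp.single v 1) ∈ Finsupp.supported ℤ ℤ s := by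
  rw [boundary_single]
  exact Submodule.sum_mem _ fun i _ ↦ Submodule.smul_mem _ _ (Finsupp.single_mem_supported _ _ (h i))

lemma cone_mem {n : ℕ} {x : K} {s : Set (Fin n → K)} {t : Set (Fin (n + 1) → K)}
    (h : ∀ v ∈ s, (Fin.cons x v : Fin (n + 1) → K) ∈ t) {c : TupleChain K n}
    (hc : c ∈ Finsupp.supported ℤ ℤ s) : cone x n c ∈ Finsupp.supported ℤ ℤ t :=
  mem_supported_of_forall
    (fun v hv ↦ by rw [cone_single]; exact Finsupp.single_mem_supported _ _ (h v hv)) hc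

lemma subdivision_mem_of_closed {s : Set K} (hs : ∀ n v, (∀ i, v i ∈ s) → b n v ∈ s) {n : ℕ}
    {c : TupleChain K n} (hc : c ∈ Finsupp.supported ℤ ℤ {v : Fin n → K | ∀ i, v i ∈ s}) :
    subdivision b n c ∈ Finsupp.supported ℤ ℤ {v : Fin n → K | ∀ i, v i ∈ s} := by
  induction n with
  | zero => exact hc
  | succ n ih =>
    refine mem_supported_of_forall (fun v hv ↦ ?_) hc
    rw [subdivision_single]
    refine cone_mem (fun w hw i ↦ ?_) (ih (boundary_single_mem fun i j ↦ hv _))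
    refine Fin.cases ?_ (fun j ↦ ?_) i
    · exact hs _ _ hv
    · exact hw j

/-- Subdivision shrinks tuples, for a choice of centres satisfying the metric inequalities of
barycentres. -/
lemma subdivision_mem_of_dist_le [PseudoMetricSpace K]
    (hball : ∀ x r n v, (∀ i, v i ∈ Metric.closedBall x r) → b n v ∈ Metric.closedBall x r)
    (hdist : ∀ D n v, (∀ i j, dist (v i) (v j) ≤ D) →
      ∀ i, dist (v i) (b n v) ≤ (n / (n + 1) : ℝ) * D) {D : ℝ} {n : ℕ}
    {c : TupleChain K n}
    (hc : c ∈ Finsupp.supported ℤ ℤ {v : Fin n → K | ∀ i j, dist (v i) (v j) ≤ D}) :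
    subdivision b n c ∈ Finsupp.supported ℤ ℤ
      {v : Fin n → K | ∀ i j, dist (v i) (v j) ≤ (n / (n + 1) : ℝ) * D} := by
  induction n with
  | zero => 
    refine mem_supported_of_forall (fun v hv ↦ ?_) hc
    exact Finsupp.single_mem_supported _ _ fun i ↦ i.elim0
  | succ n ih =>
    refine mem_supported_of_forall (fun v hv ↦ ?_) hc
    have hD : 0 ≤ D := dist_nonneg.trans (hv 0 0)
    have hle : (n / (n + 1) : ℝ) * D ≤ ((n + 1 : ℕ) / ((n + 1 : ℕ) + 1) : ℝ) * D := by
      gcongr ?_ * D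
      rw [div_le_div_iff₀ (by positivity) (by positivity)]
      push_cast
      nlinarith
    rw [subdivision_single]
    have h1 := ih (c := boundary K n (Finsupp.single v 1))
      (boundary_single_mem fun i j k ↦ hv _ _)
    have h2 := subdivision_mem_of_closed b
      (hball (b n v) ((n / (n + 1) : ℝ) * D)) (c := boundary K n (Finsupp.single v 1))
      (boundary_single_mem fun i j ↦ hdist D n v hv _)
    have h12 := Submodule.mem_inf.2 ⟨h1, h2⟩
    rw [← Finsupp.supported_inter] at h12
    refine cone_mem ?_ h12
    rintro w ⟨hw1, hw2⟩ i j
    refine le_trans ?_ hle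
    refine Fin.cases ?_ (fun i ↦ ?_) i <;> refine Fin.cases ?_ (fun j ↦ ?_) j
    · simp; positivity
    · simpa [dist_comm] using hw2 j
    · simpa using hw2 i
    · simpa using hw1 i j

end Subdivision

end TupleChain

namespace stdSimplex

variable {ι κ μ : Type} [Fintype ι] [Fintype κ] [Fintype μ]

/-- The convex combination of a family of points of a simplex. -/
noncomputable def combine (t : stdSimplex ℝ ι) (v : ι → stdSimplex ℝ κ) : stdSimplex ℝ κ :=
  ⟨fun k ↦ ∑ i, t i * v i k, fun k ↦ Finset.sum_nonneg fun i _ ↦ mul_nonneg (by simp) (by simp), by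
    rw [Finset.sum_comm]
    simp [← Finset.mul_sum]⟩

lemma combine_apply (t : stdSimplex ℝ ι) (v : ι → stdSimplex ℝ κ) (k : κ) :
    combine t v k = ∑ i, t i * v i k := rfl

lemma combine_combine (t : stdSimplex ℝ ι) (v : ι → stdSimplex ℝ κ) (w : κ → stdSimplex ℝ μ) :
    combine (combine t v) w = combine t fun i ↦ combine (v i) w := by
  ext k
  simp only [combine_apply, Finset.sum_mul, Finset.mul_sum]
  rw [Finset.sum_comm]
  simp only [mul_assoc]

lemma combine_vertex [DecidableEq ι] (t : stdSimplex ℝ ι) : combine t vertex = t := by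
  ext k
  simp [combine_apply, Pi.single_apply]

lemma combine_vertex_left [DecidableEq ι] (i : ι) (v : ι → stdSimplex ℝ κ) :
    combine (vertex i) v = v i := by
  ext k
  simp [combine_apply, Pi.single_apply]

lemma combine_map (f : ι → κ) (t : stdSimplex ℝ ι) (v : κ → stdSimplex ℝ μ) :
    combine (map f t) v = combine t (v ∘ f) := by
  classical
  ext k
  simp only [combine_apply, map_coe, FunOnFinite.linearMap_apply_apply, Finset.sum_mul]
  rw [← Finset.sum_fiberwise Finset.univ f]
  refine Finset.sum_congr rfl fun x _ ↦ Finset.sum_congr rfl fun i hi ↦ ?_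
  simp [(Finset.mem_filter.1 hi).2]

lemma continuous_combine (v : ι → stdSimplex ℝ κ) : Continuous fun t ↦ combine t v := by
  refine Continuous.subtype_mk (continuous_pi fun k ↦ continuous_finsetSum _ fun i _ ↦ ?_) _
  exact ((continuous_apply i).comp continuous_subtype_val).mul continuous_const

lemma dist_combine_le (x : stdSimplex ℝ κ) (t : stdSimplex ℝ ι) (v : ι → stdSimplex ℝ κ) :
    dist x (combine t v) ≤ ∑ i, t i * dist x (v i) := by
  refine (dist_pi_le_iff (Finset.sum_nonneg fun i _ ↦ mul_nonneg (by simp) dist_nonneg)).2 ?_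
  intro k
  have : x k - combine t v k = ∑ i, t i * (x k - v i k) := by
    simp only [combine_apply, mul_sub, Finset.sum_sub_distrib, ← Finset.sum_mul]
    simp
  change |x k - combine t v k| ≤ _
  rw [this]
  refine (Finset.abs_sum_le_sum_abs _ _).trans (Finset.sum_le_sum fun i _ ↦ ?_)
  rw [abs_mul, abs_of_nonneg (zero_le t i)]
  exact mul_le_mul_of_nonneg_left (dist_le_pi_dist (x : κ → ℝ) (v i) k) (zero_le t i)

lemma dist_combine_le_of_forall (x : stdSimplex ℝ κ) (t : stdSimplex ℝ ι)
    (v : ι → stdSimplex ℝ κ) {r : ℝ} (h : ∀ i, dist x (v i) ≤ r) : dist x (combine t v) ≤ r := by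
  refine (dist_combine_le x t v).trans
    ((Finset.sum_le_sum fun i _ ↦ mul_le_mul_of_nonneg_left (h i) (zero_le t i)).trans ?_)
  simp [← Finset.sum_mul]

/-- The barycentre of a tuple of points of a simplex. -/
noncomputable def centre (κ : Type) [Fintype κ] (n : ℕ) (v : Fin (n + 1) → stdSimplex ℝ κ) :
    stdSimplex ℝ κ :=
  combine barycenter v

lemma dist_centre_le {D : ℝ} {n : ℕ} {v : Fin (n + 1) → stdSimplex ℝ κ}
    (h : ∀ i j, dist (v i) (v j) ≤ D) (i : Fin (n + 1)) :
    dist (v i) (centre κ n v) ≤ (n / (n + 1) : ℝ) * D := by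
  refine (dist_combine_le _ _ _).trans ?_
  rw [← Finset.add_sum_erase _ _ (Finset.mem_univ i), dist_self, mul_zero, zero_add]
  refine (Finset.sum_le_card_nsmul _ _ ((n + 1 : ℝ)⁻¹ * D) fun j _ ↦ ?_).trans ?_
  · have : (barycenter : stdSimplex ℝ (Fin (n + 1))) j = (n + 1 : ℝ)⁻¹ := by
      refine (barycenter_apply j).trans (by simp)
    rw [this]
    exact mul_le_mul_of_nonneg_left (h i j) (by positivity)
  · simp [Finset.card_erase_of_mem]
    apply le_of_eq
    ring

lemma centre_mem_closedBall (x : stdSimplex ℝ κ) (r : ℝ) (n : ℕ)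
    (v : Fin (n + 1) → stdSimplex ℝ κ) (h : ∀ i, v i ∈ Metric.closedBall x r) :
    centre κ n v ∈ Metric.closedBall x r := by
  simp only [Metric.mem_closedBall, dist_comm _ x] at h ⊢
  exact dist_combine_le_of_forall _ _ _ h

/-- The affine map between simplices with prescribed values on the vertices. -/
noncomputable def affine (v : ι → stdSimplex ℝ κ) : C(stdSimplex ℝ ι, stdSimplex ℝ κ) :=
  ⟨fun t ↦ combine t v, continuous_combine v⟩

lemma affine_centre (v : ι → stdSimplex ℝ κ) (n : ℕ) (w : Fin (n + 1) → stdSimplex ℝ ι) :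
    affine v (centre ι n w) = centre κ n (affine v ∘ w) :=
  combine_combine _ _ _

end stdSimplex

/-- Singular simplices of dimension `n`. -/
abbrev SingularSimplex (X : Type) [TopologicalSpace X] (n : ℕ) : Type :=
  C(stdSimplex ℝ (Fin (n + 1)), X)

/-- The singular chain complex as a functor. -/
noncomputable def singularChainFunctor : TopCat.{0} ⥤ ChainComplex (ModuleCat.{0} ℤ) ℕ :=
  TopCat.toSSet ⋙ (CategoryTheory.SimplicialObject.whiskering (Type 0) (ModuleCat.{0} ℤ)).obj
    (ModuleCat.free ℤ) ⋙ AlgebraicTopology.alternatingFaceMapComplex (ModuleCat.{0} ℤ)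

namespace SingularChain

/-- Singular chains are free on singular simplices. -/
noncomputable def equiv (X : TopCat.{0}) (n : ℕ) :
    (SingularSimplex X n →₀ ℤ) ≃ₗ[ℤ] (singularChainFunctor.obj X).X n :=
  Finsupp.domLCongr (TopCat.toSSetObjEquiv X (.op (SimplexCategory.mk n))).symm

/-- The basis element of a singular simplex. -/
noncomputable def simplex {X : TopCat.{0}} {n : ℕ} (σ : SingularSimplex X n) :
    (singularChainFunctor.obj X).X n :=
  equiv X n (Finsupp.single σ 1)

lemma simplex_eq {X : TopCat.{0}} {n : ℕ} (σ : SingularSimplex X n) :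
    simplex σ = ModuleCat.freeMk (R := ℤ)
      ((TopCat.toSSetObjEquiv X (.op (SimplexCategory.mk n))).symm σ) := by
  exact Finsupp.domLCongr_single _ _ _

lemma map_simplex {X Y : TopCat.{0}} (f : X ⟶ Y) {n : ℕ} (σ : SingularSimplex X n) :
    (singularChainFunctor.map f).f n (simplex σ) = simplex (f.hom.comp σ) := by
  rw [simplex_eq, simplex_eq]
  exact ModuleCat.free_map_apply (R := ℤ) _ _

lemma d_simplex {X : TopCat.{0}} {n : ℕ} (σ : SingularSimplex X (n + 1)) :
    (singularChainFunctor.obj X).d (n + 1) n (simplex σ) =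
      ∑ i : Fin (n + 2), (-1 : ℤ) ^ (i : ℕ) • simplex
        (σ.comp ⟨stdSimplex.map i.succAbove, stdSimplex.continuous_map _⟩) := by
  have hd : (singularChainFunctor.obj X).d (n + 1) n = ∑ i : Fin (n + 2), (-1 : ℤ) ^ (i : ℕ) •
      (ModuleCat.free ℤ).map ((TopCat.toSSet.obj X).δ i) :=
    AlgebraicTopology.alternatingFaceMapComplex_obj_d _ _
  have hsum {M N : ModuleCat.{0} ℤ} (f : Fin (n + 2) → (M ⟶ N)) (x : M) :
      (∑ i : Fin (n + 2), (-1 : ℤ) ^ (i : ℕ) • f i) x =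
        ∑ i : Fin (n + 2), (-1 : ℤ) ^ (i : ℕ) • f i x := by
    simp [ModuleCat.hom_sum]
  rw [hd, simplex_eq]
  refine (hsum _ _).trans (Finset.sum_congr rfl fun i _ ↦ ?_)
  rw [simplex_eq]
  congr 1
  exact ModuleCat.free_map_apply (R := ℤ) _ _

open stdSimplex

variable {X : TopCat.{0}}

/-- The chain of affine singular simplices attached to a chain of tuples of points in the source
of a singular simplex. -/
noncomputable def realize {m : ℕ} (σ : SingularSimplex X m) (n : ℕ) :
    TupleChain (stdSimplex ℝ (Fin (m + 1))) (n + 1) →ₗ[ℤ] (singularChainFunctor.obj X).X n :=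
  Finsupp.linearCombination ℤ fun v ↦ simplex (σ.comp (affine v))

lemma realize_single {m : ℕ} (σ : SingularSimplex X m) {n : ℕ}
    (v : Fin (n + 1) → stdSimplex ℝ (Fin (m + 1))) :
    realize σ n (Finsupp.single v 1) = simplex (σ.comp (affine v)) := by
  simp only [realize, Finsupp.linearCombination_single]
  exact one_smul ℤ _

lemma realize_vertex {m : ℕ} (σ : SingularSimplex X m) :
    realize σ m (Finsupp.single vertex 1) = simplex σ := by
  rw [realize_single]
  congr 1
  ext t
  exact congrArg σ (combine_vertex t)

lemma d_realize {m : ℕ} (σ : SingularSimplex X m) {n : ℕ}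
    (c : TupleChain (stdSimplex ℝ (Fin (m + 1))) (n + 2)) :
    (singularChainFunctor.obj X).d (n + 1) n (realize σ (n + 1) c) =
      realize σ n (TupleChain.boundary _ (n + 1) c) := by
  suffices ((singularChainFunctor.obj X).d (n + 1) n).hom ∘ₗ realize σ (n + 1) =
      realize σ n ∘ₗ TupleChain.boundary _ (n + 1) from LinearMap.congr_fun this c
  ext1 v
  ext1
  simp only [LinearMap.comp_apply, Finsupp.lsingle_apply, realize_single, d_simplex,
    TupleChain.boundary_single, map_sum]
  refine Finset.sum_congr rfl fun i _ ↦ ?_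
  rw [map_zsmul, realize_single]
  congr 2
  ext t
  exact congrArg σ (combine_map _ _ _)

lemma realize_affine {m k : ℕ} (σ : SingularSimplex X m)
    (v : Fin (k + 1) → stdSimplex ℝ (Fin (m + 1))) {n : ℕ}
    (c : TupleChain (stdSimplex ℝ (Fin (k + 1))) (n + 1)) :
    realize (σ.comp (affine v)) n c = realize σ n (TupleChain.map (affine v) (n + 1) c) := by
  suffices realize (σ.comp (affine v)) n = realize σ n ∘ₗ TupleChain.map (affine v) (n + 1) from
    LinearMap.congr_fun this c
  ext1 w
  ext1
  simp only [LinearMap.comp_apply, Finsupp.lsingle_apply, realize_single, TupleChain.map_single]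
  congr 1
  ext t
  exact congrArg σ (combine_combine _ _ _)

lemma hom_ext {n : ℕ} {M : Type} [AddCommGroup M] [Module ℤ M]
    {f g : (singularChainFunctor.obj X).X n →ₗ[ℤ] M}
    (h : ∀ σ : SingularSimplex X n, f (simplex σ) = g (simplex σ)) : f = g := by
  suffices f ∘ₗ (equiv X n).toLinearMap = g ∘ₗ (equiv X n).toLinearMap by
    ext c
    simpa using LinearMap.congr_fun this ((equiv X n).symm c)
  ext1 σ
  ext1
  exact h σ

lemma span_simplex (X : TopCat.{0}) (n : ℕ) :
    Submodule.span ℤ (Set.range fun σ : SingularSimplex X n ↦ simplex σ) = ⊤ := by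
  refine top_unique fun c _ ↦ ?_
  obtain ⟨c, rfl⟩ := (equiv X n).surjective c
  induction c using Finsupp.induction_linear with
  | zero => simp
  | add f g hf hg => rw [map_add]; exact Submodule.add_mem _ (hf trivial) (hg trivial)
  | single σ z =>
    have : equiv X n (Finsupp.single σ z) = z • simplex σ := by
      rw [simplex, ← map_smul]; simp
    rw [this]
    exact Submodule.smul_mem _ _ (Submodule.subset_span ⟨σ, rfl⟩)

/-- The homotopy between the identity and barycentric subdivision on singular chains. -/
noncomputable def homotopy (X : TopCat.{0}) (n : ℕ) :
    (singularChainFunctor.obj X).X n →ₗ[ℤ] (singularChainFunctor.obj X).X (n + 1) :=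
  Finsupp.linearCombination ℤ (fun σ : SingularSimplex X n ↦ realize σ (n + 1)
    (TupleChain.homotopy (centre _) (n + 1) (Finsupp.single vertex 1))) ∘ₗ (equiv X n).symm

lemma homotopy_simplex {n : ℕ} (σ : SingularSimplex X n) :
    homotopy X n (simplex σ) = realize σ (n + 1)
      (TupleChain.homotopy (centre _) (n + 1) (Finsupp.single vertex 1)) := by
  simp only [homotopy, simplex, LinearMap.comp_apply, LinearEquiv.coe_coe,
    LinearEquiv.symm_apply_apply, Finsupp.linearCombination_single]
  exact one_smul ℤ _

lemma homotopy_realize {m : ℕ} (σ : SingularSimplex X m) {n : ℕ}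
    (c : TupleChain (stdSimplex ℝ (Fin (m + 1))) (n + 1)) :
    homotopy X n (realize σ n c) =
      realize σ (n + 1) (TupleChain.homotopy (centre _) (n + 1) c) := by
  suffices homotopy X n ∘ₗ realize σ n =
      realize σ (n + 1) ∘ₗ TupleChain.homotopy (centre _) (n + 1) from LinearMap.congr_fun this c
  ext1 v
  ext1
  simp only [LinearMap.comp_apply, Finsupp.lsingle_apply, realize_single, homotopy_simplex,
    realize_affine]
  rw [TupleChain.map_homotopy _ (centre _) (fun n w ↦ affine_centre v n w), TupleChain.map_single]
  congr 3
  ext1 i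
  exact combine_vertex_left i v

/-- Barycentric subdivision of singular chains. -/
noncomputable def subdivision (X : TopCat.{0}) : ∀ n : ℕ,
    (singularChainFunctor.obj X).X n →ₗ[ℤ] (singularChainFunctor.obj X).X n
  | 0 => LinearMap.id - ((singularChainFunctor.obj X).d 1 0).hom ∘ₗ homotopy X 0
  | n + 1 => LinearMap.id - ((singularChainFunctor.obj X).d (n + 2) (n + 1)).hom ∘ₗ
      homotopy X (n + 1) - homotopy X n ∘ₗ ((singularChainFunctor.obj X).d (n + 1) n).hom

lemma subdivision_realize {m : ℕ} (σ : SingularSimplex X m) {n : ℕ}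
    (c : TupleChain (stdSimplex ℝ (Fin (m + 1))) (n + 1)) :
    subdivision X n (realize σ n c) =
      realize σ n (TupleChain.subdivision (centre _) (n + 1) c) := by
  cases n with
  | zero =>
    simp [subdivision, TupleChain.subdivision, homotopy_realize, d_realize,
      TupleChain.homotopy.eq_1]
  | succ n =>
    simp [subdivision, TupleChain.subdivision, homotopy_realize, d_realize]

/-- Chains of simplices contained in some member of `s`. -/
noncomputable def smallChains (s : Set (Set X)) (n : ℕ) : Submodule ℤ ((singularChainFunctor.obj X).X n) :=
  Submodule.span ℤ {c | ∃ σ : SingularSimplex X n, (∃ U ∈ s, Set.range σ ⊆ U) ∧ simplex σ = c}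

variable {s : Set (Set X)}

lemma simplex_mem_smallChains {n : ℕ} {σ : SingularSimplex X n} {U : Set X} (hU : U ∈ s)
    (hσ : Set.range σ ⊆ U) : simplex σ ∈ smallChains s n :=
  Submodule.subset_span ⟨σ, ⟨U, hU, hσ⟩, rfl⟩

lemma realize_mem_smallChains {m : ℕ} (σ : SingularSimplex X m) {n : ℕ}
    {t : Set (Fin (n + 1) → stdSimplex ℝ (Fin (m + 1)))}
    (ht : ∀ v ∈ t, ∃ U ∈ s, Set.range (σ.comp (affine v)) ⊆ U)
    {c : TupleChain (stdSimplex ℝ (Fin (m + 1))) (n + 1)} (hc : c ∈ Finsupp.supported ℤ ℤ t) :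
    realize σ n c ∈ smallChains s n := by
  rw [Finsupp.supported_eq_span_single] at hc
  have : Submodule.span ℤ ((fun i ↦ Finsupp.single i (1 : ℤ)) '' t) ≤
      (smallChains s n).comap (realize σ n) := by
    rw [Submodule.span_le]
    rintro _ ⟨v, hv, rfl⟩
    obtain ⟨U, hU, h⟩ := ht v hv
    simpa [realize_single] using simplex_mem_smallChains hU h
  exact this hc

lemma homotopy_mem_smallChains {n : ℕ} {c : (singularChainFunctor.obj X).X n}
    (hc : c ∈ smallChains s n) : homotopy X n c ∈ smallChains s (n + 1) := by
  have : smallChains s n ≤ (smallChains s (n + 1)).comap (homotopy X n) := by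
    rw [smallChains, Submodule.span_le]
    rintro _ ⟨σ, ⟨U, hU, hσ⟩, rfl⟩
    change homotopy X n (simplex σ) ∈ smallChains s (n + 1)
    rw [homotopy_simplex]
    refine realize_mem_smallChains σ (t := Set.univ) (fun v _ ↦ ⟨U, hU, ?_⟩) (by simp)
    exact (Set.range_comp_subset_range _ σ).trans hσ
  exact this hc

lemma d_mem_smallChains {n : ℕ} {c : (singularChainFunctor.obj X).X (n + 1)}
    (hc : c ∈ smallChains s (n + 1)) :
    (singularChainFunctor.obj X).d (n + 1) n c ∈ smallChains s n := by
  have : smallChains s (n + 1) ≤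
      (smallChains s n).comap ((singularChainFunctor.obj X).d (n + 1) n).hom := by
    rw [smallChains, Submodule.span_le]
    rintro _ ⟨σ, ⟨U, hU, hσ⟩, rfl⟩
    change (singularChainFunctor.obj X).d (n + 1) n (simplex σ) ∈ smallChains s n
    rw [d_simplex]
    refine Submodule.sum_mem _ fun i _ ↦ Submodule.smul_mem _ _ (simplex_mem_smallChains hU ?_)
    exact (Set.range_comp_subset_range _ σ).trans hσ
  exact this hc

lemma subdivision_mem_smallChains {n : ℕ} {c : (singularChainFunctor.obj X).X n}
    (hc : c ∈ smallChains s n) : subdivision X n c ∈ smallChains s n := by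
  cases n with
  | zero => exact Submodule.sub_mem _ hc (d_mem_smallChains (homotopy_mem_smallChains hc))
  | succ n =>
    exact Submodule.sub_mem _
      (Submodule.sub_mem _ hc (d_mem_smallChains (homotopy_mem_smallChains hc)))
      (homotopy_mem_smallChains (d_mem_smallChains hc))

lemma iterate_subdivision_mem_smallChains {n : ℕ} {c : (singularChainFunctor.obj X).X n}
    (hc : c ∈ smallChains s n) (k : ℕ) : (subdivision X n)^[k] c ∈ smallChains s n := by
  induction k with
  | zero => exact hc
  | succ k ih => rw [Function.iterate_succ_apply']; exact subdivision_mem_smallChains ih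

lemma exists_iterate_subdivision_simplex_mem (hs : ∀ U ∈ s, IsOpen U) (hcov : ⋃₀ s = Set.univ)
    {n : ℕ} (σ : SingularSimplex X n) :
    ∃ k, (subdivision X n)^[k] (simplex σ) ∈ smallChains s n := by
  obtain ⟨δ, hδ, hball⟩ := lebesgue_number_lemma_of_metric_sUnion
    (s := (Set.univ : Set (stdSimplex ℝ (Fin (n + 1))))) isCompact_univ
    (c := (fun U ↦ σ ⁻¹' U) '' s)
    (by rintro _ ⟨U, hU, rfl⟩; exact (hs U hU).preimage σ.continuous)
    (fun x _ ↦ by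
      obtain ⟨U, hU, hx⟩ := Set.mem_sUnion.1 (hcov ▸ Set.mem_univ (σ x) : σ x ∈ ⋃₀ s)
      exact ⟨_, ⟨U, hU, rfl⟩, hx⟩)
  set r : ℝ := (n + 1 : ℕ) / ((n + 1 : ℕ) + 1) with hr
  have hr0 : 0 ≤ r := by positivity
  have hr1 : r < 1 := by rw [hr, div_lt_one (by positivity)]; linarith
  obtain ⟨k, hk⟩ := exists_pow_lt_of_lt_one hδ hr1
  refine ⟨k, ?_⟩
  have key (k : ℕ) : (subdivision X n)^[k] (simplex σ) = realize σ n
      ((TupleChain.subdivision (centre _) (n + 1))^[k] (Finsupp.single vertex 1)) := by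
    induction k with
    | zero => exact (realize_vertex σ).symm
    | succ k ih => rw [Function.iterate_succ_apply', ih, subdivision_realize,
        Function.iterate_succ_apply']
  have hsupp (k : ℕ) : (TupleChain.subdivision (centre _) (n + 1))^[k]
      (Finsupp.single vertex 1) ∈ Finsupp.supported ℤ ℤ
        {v : Fin (n + 1) → stdSimplex ℝ (Fin (n + 1)) | ∀ i j, dist (v i) (v j) ≤ r ^ k} := by
    induction k with
    | zero =>
      refine Finsupp.single_mem_supported _ _ fun i j ↦ ?_
      rw [pow_zero]
      exact (Metric.dist_le_diam_of_mem (bounded_stdSimplex _)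
        (Subtype.property _) (Subtype.property _)).trans diam_stdSimplex_le
    | succ k ih =>
      rw [Function.iterate_succ_apply', pow_succ']
      exact TupleChain.subdivision_mem_of_dist_le _ centre_mem_closedBall
        (fun D n v h i ↦ dist_centre_le h i) ih
  rw [key]
  refine realize_mem_smallChains σ (fun v hv ↦ ?_) (hsupp k)
  obtain ⟨_, ⟨U, hU, rfl⟩, hx⟩ := hball (v 0) trivial
  refine ⟨U, hU, ?_⟩
  rintro _ ⟨t, rfl⟩
  refine hx ?_
  rw [Metric.mem_ball']
  exact (dist_combine_le_of_forall _ _ _ fun i ↦ hv 0 i).trans_lt hk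

lemma exists_iterate_subdivision_mem (hs : ∀ U ∈ s, IsOpen U) (hcov : ⋃₀ s = Set.univ)
    {n : ℕ} (c : (singularChainFunctor.obj X).X n) :
    ∃ k, (subdivision X n)^[k] c ∈ smallChains s n := by
  have hc : c ∈ Submodule.span ℤ (Set.range fun σ : SingularSimplex X n ↦ simplex σ) := by
    rw [span_simplex]; trivial
  induction hc using Submodule.span_induction with
  | mem x h =>
    obtain ⟨σ, rfl⟩ := h
    exact exists_iterate_subdivision_simplex_mem hs hcov σ
  | zero => exact ⟨0, Submodule.zero_mem _⟩
  | add x y _ _ hx hy =>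
    obtain ⟨k, hk⟩ := hx
    obtain ⟨l, hl⟩ := hy
    refine ⟨k + l, ?_⟩
    rw [iterate_map_add]
    refine Submodule.add_mem _ ?_ ?_
    · rw [add_comm, Function.iterate_add_apply]
      exact iterate_subdivision_mem_smallChains hk l
    · rw [Function.iterate_add_apply]
      exact iterate_subdivision_mem_smallChains hl k
  | smul a x _ hx =>
    obtain ⟨k, hk⟩ := hx
    refine ⟨k, ?_⟩
    rw [← Module.End.pow_apply, map_smul, Module.End.pow_apply]
    exact Submodule.smul_mem _ _ hk

/-- A chain whose boundary is small is homologous to a small chain. -/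
theorem exists_sub_d_mem_smallChains (hs : ∀ U ∈ s, IsOpen U) (hcov : ⋃₀ s = Set.univ) {n : ℕ}
    (c : (singularChainFunctor.obj X).X n)
    (hc : ∀ m, m + 1 = n → (singularChainFunctor.obj X).d n m c ∈ smallChains s m) :
    ∃ e, c - (singularChainFunctor.obj X).d (n + 1) n e ∈ smallChains s n := by
  obtain ⟨k, hk⟩ := exists_iterate_subdivision_mem hs hcov c
  induction k generalizing c with
  | zero => exact ⟨0, by simpa using hk⟩
  | succ k ih =>
    have hsub : c - (singularChainFunctor.obj X).d (n + 1) n (homotopy X n c) - subdivision X n c ∈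
        smallChains s n := by
      cases n with
      | zero => simp [subdivision]
      | succ n => simpa [subdivision] using homotopy_mem_smallChains (hc n rfl)
    obtain ⟨e, he⟩ := ih (subdivision X n c) (by
      rintro m rfl
      have hdc := hc m rfl
      have : (singularChainFunctor.obj X).d (m + 1) m (subdivision X (m + 1) c) =
          (singularChainFunctor.obj X).d (m + 1) m c - (singularChainFunctor.obj X).d (m + 1) m
            (homotopy X m ((singularChainFunctor.obj X).d (m + 1) m c)) := by
        have hdd (x) : (singularChainFunctor.obj X).d (m + 1) m
            ((singularChainFunctor.obj X).d (m + 2) (m + 1) x) = 0 :=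
          ConcreteCategory.congr_hom ((singularChainFunctor.obj X).d_comp_d (m + 2) (m + 1) m) x
        simp [subdivision, hdd]
      rw [this]
      exact Submodule.sub_mem _ hdc (d_mem_smallChains (homotopy_mem_smallChains hdc))) hk
    refine ⟨homotopy X n c + e, ?_⟩
    rw [map_add]
    convert Submodule.add_mem _ hsub he using 1
    abel

end SingularChain

namespace ChainComplex

open Limits HomologicalComplex

variable (S : ShortComplex (ChainComplex (ModuleCat.{0} ℤ) ℕ))

/-- `S.g` hits every homology class of `S.X₃`, relatively to its image. -/
def IsLiftable : Prop :=
  ∀ (n : ℕ) (c : S.X₃.X n),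
    (∀ m, m + 1 = n → S.X₃.d n m c ∈ LinearMap.range (S.g.f m).hom) →
      ∃ e, c - S.X₃.d (n + 1) n e ∈ LinearMap.range (S.g.f n).hom

variable {S}

lemma exactAt_of_forall {Q : ChainComplex (ModuleCat.{0} ℤ) ℕ} {n : ℕ}
    (h : ∀ x : Q.X n, (∀ m, m + 1 = n → Q.d n m x = 0) → ∃ y, Q.d (n + 1) n y = x) :
    Q.ExactAt n := by
  rw [exactAt_iff' Q (n + 1) n (n - 1) (by simp) (by cases n <;> simp),
    ShortComplex.moduleCat_exact_iff]
  intro x hx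
  refine h x ?_
  rintro m rfl
  exact hx

lemma exactAt_cokernel_of_isLiftable (h : IsLiftable S) (n : ℕ) : (cokernel S.g).ExactAt n := by
  have hex : (ShortComplex.mk S.g (cokernel.π S.g) (cokernel.condition _)).Exact :=
    ShortComplex.exact_cokernel _
  rw [exact_iff_degreewise_exact] at hex
  have hsurj (i : ℕ) : Function.Surjective ((cokernel.π S.g).f i) :=
    (ModuleCat.epi_iff_surjective _).1 inferInstance
  have hcomm (i j : ℕ) (c : S.X₃.X i) : (cokernel S.g).d i j ((cokernel.π S.g).f i c) =
      (cokernel.π S.g).f j (S.X₃.d i j c) :=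
    ConcreteCategory.congr_hom ((cokernel.π S.g).comm i j) c
  have hzero (i : ℕ) (b : S.X₂.X i) : (cokernel.π S.g).f i (S.g.f i b) = 0 :=
    ConcreteCategory.congr_hom (congr_hom (cokernel.condition S.g) i) b
  refine exactAt_of_forall fun x hx ↦ ?_
  obtain ⟨c, rfl⟩ := hsurj n x
  obtain ⟨e, b, hb⟩ := h n c fun m hm ↦ by
    have := hx m hm
    rw [hcomm] at this
    exact (ShortComplex.moduleCat_exact_iff _).1 (hex m) _ this
  refine ⟨(cokernel.π S.g).f _ e, ?_⟩
  rw [hcomm, eq_comm, ← sub_eq_zero, ← map_sub]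
  exact hb ▸ hzero n b

lemma isIso_homologyMap_image_ι (h : IsLiftable S) (n : ℕ) :
    IsIso (homologyMap (image.ι S.g) n) := by
  have w : image.ι S.g ≫ cokernel.π S.g = 0 := by rw [← cancel_epi (factorThruImage S.g)]; simp
  let φ : ShortComplex.mk S.g (cokernel.π S.g) (cokernel.condition _) ⟶
      ShortComplex.mk (image.ι S.g) (cokernel.π S.g) w :=
    { τ₁ := factorThruImage S.g, τ₂ := 𝟙 _, τ₃ := 𝟙 _ }
  have : Epi φ.τ₁ := inferInstanceAs (Epi (factorThruImage S.g))
  have : IsIso φ.τ₂ := inferInstanceAs (IsIso (𝟙 _))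
  have : Mono φ.τ₃ := inferInstanceAs (Mono (𝟙 _))
  have hS : (ShortComplex.mk (image.ι S.g) (cokernel.π S.g) w).ShortExact :=
    { exact := (ShortComplex.exact_iff_of_epi_of_isIso_of_mono φ).1
        (ShortComplex.exact_cokernel S.g)
      mono_f := inferInstanceAs (Mono (image.ι S.g))
      epi_g := inferInstanceAs (Epi (cokernel.π S.g)) }
  have hz (i : ℕ) : IsZero ((cokernel S.g).homology i) :=
    (exactAt_cokernel_of_isLiftable h i).isZero_homology
  have h1 : Epi (homologyMap (image.ι S.g) n) :=
    (hS.homology_exact₂ n).epi_f ((hz n).eq_of_tgt _ _)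
  have h2 : Mono (homologyMap (image.ι S.g) n) :=
    (hS.homology_exact₁ (n + 1) n (by simp)).mono_g ((hz _).eq_of_src _ _)
  exact isIso_of_mono_of_epi _

lemma comp_factorThruImage (S : ShortComplex (ChainComplex (ModuleCat.{0} ℤ) ℕ)) :
    S.f ≫ factorThruImage S.g = 0 := by
  rw [← cancel_mono (image.ι S.g)]
  simp

lemma shortExact_factorThruImage [Mono S.f] (hS : S.Exact) :
    (ShortComplex.mk S.f (factorThruImage S.g) (comp_factorThruImage S)).ShortExact := by
  let φ : ShortComplex.mk S.f (factorThruImage S.g) (comp_factorThruImage S) ⟶ S :=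
    { τ₁ := 𝟙 _, τ₂ := 𝟙 _, τ₃ := image.ι S.g }
  have : Epi φ.τ₁ := inferInstanceAs (Epi (𝟙 _))
  have : IsIso φ.τ₂ := inferInstanceAs (IsIso (𝟙 _))
  have : Mono φ.τ₃ := inferInstanceAs (Mono (image.ι S.g))
  exact
    { exact := (ShortComplex.exact_iff_of_epi_of_isIso_of_mono φ).2 hS
      mono_f := inferInstanceAs (Mono S.f)
      epi_g := inferInstanceAs (Epi (factorThruImage S.g)) }

lemma homologyMap_factor (S : ShortComplex (ChainComplex (ModuleCat.{0} ℤ) ℕ)) (n : ℕ) :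
    homologyMap S.g n =
      homologyMap (factorThruImage S.g) n ≫ homologyMap (image.ι S.g) n := by
  rw [← homologyMap_comp, image.fac]

lemma homologyMap_image_ι_bijective (h : IsLiftable S) (n : ℕ) :
    Function.Bijective (homologyMap (image.ι S.g) n).hom := by
  have := isIso_homologyMap_image_ι h n
  exact ⟨(ModuleCat.mono_iff_injective _).1 inferInstance,
    (ModuleCat.epi_iff_surjective _).1 inferInstance⟩

theorem homology_exact_of_isLiftable [Mono S.f] (hS : S.Exact) (h : IsLiftable S) (n : ℕ) :
    Function.Exact (homologyMap S.f n).hom (homologyMap S.g n).hom := by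
  have hE := (ShortComplex.ShortExact.moduleCat_exact_iff_function_exact _).1
    ((shortExact_factorThruImage hS).homology_exact₂ n)
  intro x
  refine Iff.trans ?_ (hE x)
  rw [homologyMap_factor, ModuleCat.hom_comp]
  exact map_eq_zero_iff _ (homologyMap_image_ι_bijective h n).1

theorem homologyMap_surjective_of_isLiftable (h : IsLiftable S) :
    Function.Surjective (homologyMap S.g 0).hom := by
  have : Epi (homologyMap (factorThruImage S.g) 0) :=
    epi_homologyMap_of_epi_of_not_rel _ _ (by simp)
  rw [homologyMap_factor, ModuleCat.hom_comp]
  exact (homologyMap_image_ι_bijective h 0).2.comp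
    ((ModuleCat.epi_iff_surjective (homologyMap (factorThruImage S.g) 0)).1 inferInstance)

theorem exists_connecting_of_isLiftable [Mono S.f] (hS : S.Exact) (h : IsLiftable S) (n : ℕ) :
    ∃ δ : S.X₃.homology (n + 1) →ₗ[ℤ] S.X₁.homology n,
      Function.Exact (homologyMap S.g (n + 1)).hom δ ∧
        Function.Exact δ (homologyMap S.f n).hom := by
  have hS' := shortExact_factorThruImage hS
  have h1 := (ShortComplex.ShortExact.moduleCat_exact_iff_function_exact _).1
    (hS'.homology_exact₁ (n + 1) n (by simp))
  have h3 := (ShortComplex.ShortExact.moduleCat_exact_iff_function_exact _).1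
    (hS'.homology_exact₃ (n + 1) n (by simp))
  let e := LinearEquiv.ofBijective _ (homologyMap_image_ι_bijective h (n + 1))
  have hfac (y : S.X₂.homology (n + 1)) : (homologyMap S.g (n + 1)).hom y =
      e ((homologyMap (factorThruImage S.g) (n + 1)).hom y) := by
    rw [homologyMap_factor]
    rfl
  refine ⟨(hS'.δ (n + 1) n (by simp)).hom ∘ₗ e.symm.toLinearMap, fun x ↦ ?_, fun x ↦ ?_⟩
  · refine (h3 (e.symm x)).trans ?_
    constructor
    · rintro ⟨y, hy⟩
      exact ⟨y, (hfac y).trans ((congrArg e hy).trans (e.apply_symm_apply x))⟩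
    · rintro ⟨y, rfl⟩
      exact ⟨y, (e.symm_apply_apply _).symm.trans (congrArg e.symm (hfac y).symm)⟩
  · refine (h1 x).trans ?_
    constructor
    · rintro ⟨y, rfl⟩
      exact ⟨e y, congrArg (hS'.δ (n + 1) n (by simp)).hom (e.symm_apply_apply y)⟩
    · rintro ⟨y, rfl⟩
      exact ⟨e.symm y, rfl⟩

end ChainComplex

namespace SingularChain

open Limits HomologicalComplex

variable {X Y : TopCat.{0}}

/-- The map of spaces given by the inclusion of a subset. -/
def incl (U : Set X) : TopCat.of U ⟶ X := TopCat.ofHom ⟨Subtype.val, continuous_subtype_val⟩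

/-- The map of spaces given by an inclusion of subsets. -/
def inclOfLE {U V : Set X} (h : U ⊆ V) : TopCat.of U ⟶ TopCat.of V :=
  TopCat.ofHom ⟨Set.inclusion h, continuous_inclusion h⟩

lemma inclOfLE_incl {U V : Set X} (h : U ⊆ V) : inclOfLE h ≫ incl V = incl U := rfl

lemma map_equiv (f : X ⟶ Y) (n : ℕ) (c : SingularSimplex X n →₀ ℤ) :
    (singularChainFunctor.map f).f n (equiv X n c) =
      equiv Y n (Finsupp.mapDomain (fun σ ↦ f.hom.comp σ) c) := by
  suffices ((singularChainFunctor.map f).f n).hom ∘ₗ (equiv X n).toLinearMap =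
      (equiv Y n).toLinearMap ∘ₗ Finsupp.lmapDomain ℤ ℤ (fun σ ↦ f.hom.comp σ) from
    LinearMap.congr_fun this c
  ext1 σ
  ext1
  simp only [LinearMap.comp_apply, Finsupp.lsingle_apply, Finsupp.lmapDomain_apply,
    Finsupp.mapDomain_single]
  exact map_simplex f σ

lemma map_injective (f : X ⟶ Y) (hf : Function.Injective f) (n : ℕ) :
    Function.Injective ((singularChainFunctor.map f).f n) := by
  intro x y h
  obtain ⟨x, rfl⟩ := (equiv X n).surjective x
  obtain ⟨y, rfl⟩ := (equiv X n).surjective y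
  rw [map_equiv, map_equiv] at h
  refine congrArg _ (Finsupp.mapDomain_injective ?_ ((equiv Y n).injective h))
  intro σ τ hστ
  ext t
  exact hf (ContinuousMap.congr_fun hστ t)

instance (U : Set X) : Mono (singularChainFunctor.map (incl U)) :=
  mono_of_mono_f _ fun n ↦ (ModuleCat.mono_iff_injective _).2
    (map_injective _ Subtype.val_injective n)

instance {U V : Set X} (h : U ⊆ V) : Mono (singularChainFunctor.map (inclOfLE h)) :=
  mono_of_mono_f _ fun n ↦ (ModuleCat.mono_iff_injective _).2
    (map_injective _ (Set.inclusion_injective h) n)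

/-- The corestriction of a singular simplex to a subset containing its image. -/
def corestrict {U : Set X} {n : ℕ} (σ : SingularSimplex X n) (h : Set.range σ ⊆ U) :
    SingularSimplex U n :=
  ⟨fun t ↦ ⟨σ t, h ⟨t, rfl⟩⟩, by fun_prop⟩

lemma range_comp_incl (U : Set X) (n : ℕ) :
    Set.range (fun σ : SingularSimplex U n ↦ (incl U).hom.comp σ) =
      {σ : SingularSimplex X n | Set.range σ ⊆ U} := by
  ext σ
  constructor
  · rintro ⟨τ, rfl⟩
    rintro _ ⟨t, rfl⟩
    exact (τ t).2
  · intro h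
    exact ⟨corestrict σ h, rfl⟩

lemma mem_range_map_incl_iff (U : Set X) {n : ℕ} (c : SingularSimplex X n →₀ ℤ) :
    (∃ x, (singularChainFunctor.map (incl U)).f n x = equiv X n c) ↔
      c ∈ Finsupp.supported ℤ ℤ {σ : SingularSimplex X n | Set.range σ ⊆ U} := by
  rw [← range_comp_incl, ← Set.image_univ, ← Finsupp.lmapDomain_supported, Finsupp.supported_univ]
  constructor
  · rintro ⟨x, hx⟩
    obtain ⟨x, rfl⟩ := (equiv _ n).surjective x
    rw [map_equiv] at hx
    exact ⟨x, trivial, (equiv X n).injective hx⟩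
  · rintro ⟨x, -, rfl⟩
    exact ⟨equiv _ n x, map_equiv _ _ _⟩

lemma exists_inter {U V : Set X} {n : ℕ} {x : (singularChainFunctor.obj (TopCat.of U)).X n}
    {y : (singularChainFunctor.obj (TopCat.of V)).X n}
    (h : (singularChainFunctor.map (incl U)).f n x = (singularChainFunctor.map (incl V)).f n y) :
    ∃ w : (singularChainFunctor.obj (TopCat.of (U ∩ V : Set X))).X n,
      (singularChainFunctor.map (inclOfLE Set.inter_subset_left)).f n w = x ∧
      (singularChainFunctor.map (inclOfLE Set.inter_subset_right)).f n w = y := by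
  obtain ⟨c, hc⟩ := (equiv X n).surjective ((singularChainFunctor.map (incl U)).f n x)
  have hU := (mem_range_map_incl_iff U c).1 ⟨x, hc.symm⟩
  have hV := (mem_range_map_incl_iff V c).1 ⟨y, h.symm.trans hc.symm⟩
  obtain ⟨w, hw⟩ := (mem_range_map_incl_iff (U ∩ V) c).2 (by
    have : {σ : SingularSimplex X n | Set.range σ ⊆ U ∩ V} =
        {σ : SingularSimplex X n | Set.range σ ⊆ U} ∩
          {σ : SingularSimplex X n | Set.range σ ⊆ V} := by
      ext σ
      exact Set.subset_inter_iff
    rw [this, Finsupp.supported_inter]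
    exact ⟨hU, hV⟩)
  have key {A : Set X} (hA : U ∩ V ⊆ A) : (singularChainFunctor.map (incl A)).f n
      ((singularChainFunctor.map (inclOfLE hA)).f n w) = equiv X n c := by
    rw [← hw, ← inclOfLE_incl hA, Functor.map_comp]
    rfl
  refine ⟨w, map_injective (incl U) Subtype.val_injective n ?_,
    map_injective (incl V) Subtype.val_injective n ?_⟩
  · rw [key, hc]
  · rw [key, hc, h]

/-- The Mayer–Vietoris sequence of singular chain complexes. -/
noncomputable def mayerVietoris (U V : Set X) : ShortComplex (ChainComplex (ModuleCat.{0} ℤ) ℕ) :=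
  ShortComplex.mk
    (biprod.lift (singularChainFunctor.map (inclOfLE (Set.inter_subset_left (s := U) (t := V))))
      (-singularChainFunctor.map (inclOfLE (Set.inter_subset_right (s := U) (t := V)))))
    (biprod.desc (singularChainFunctor.map (incl U)) (singularChainFunctor.map (incl V))) (by
      rw [biprod.lift_desc, Preadditive.neg_comp, ← Functor.map_comp, ← Functor.map_comp,
        inclOfLE_incl, inclOfLE_incl, add_neg_cancel])

instance (U V : Set X) : Mono (mayerVietoris U V).f := by
  have : Mono ((mayerVietoris U V).f ≫ biprod.fst) := by
    dsimp [mayerVietoris]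
    rw [biprod.lift_fst]
    infer_instance
  exact mono_of_mono _ biprod.fst

lemma biprod_decomp {A B : ChainComplex (ModuleCat.{0} ℤ) ℕ} {n : ℕ} (c : (A ⊞ B).X n) :
    (biprod.inl : A ⟶ A ⊞ B).f n ((biprod.fst : A ⊞ B ⟶ A).f n c) +
      (biprod.inr : B ⟶ A ⊞ B).f n ((biprod.snd : A ⊞ B ⟶ B).f n c) = c :=
  ConcreteCategory.congr_hom (congr_hom (biprod.total (X := A) (Y := B)) n) c

lemma desc_apply {A B C : ChainComplex (ModuleCat.{0} ℤ) ℕ} (f : A ⟶ C) (g : B ⟶ C) {n : ℕ}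
    (c : (A ⊞ B).X n) : (biprod.desc f g).f n c =
      f.f n ((biprod.fst : A ⊞ B ⟶ A).f n c) + g.f n ((biprod.snd : A ⊞ B ⟶ B).f n c) := by
  have : biprod.desc f g = biprod.fst ≫ f + biprod.snd ≫ g := by
    apply biprod.hom_ext' <;> simp
  rw [this]
  rfl

lemma lift_apply {A B C : ChainComplex (ModuleCat.{0} ℤ) ℕ} (f : C ⟶ A) (g : C ⟶ B) {n : ℕ}
    (c : C.X n) : (biprod.lift f g).f n c =
      (biprod.inl : A ⟶ A ⊞ B).f n (f.f n c) + (biprod.inr : B ⟶ A ⊞ B).f n (g.f n c) := by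
  have : biprod.lift f g = f ≫ biprod.inl + g ≫ biprod.inr := by
    apply biprod.hom_ext <;> simp
  rw [this]
  rfl

lemma mayerVietoris_exact (U V : Set X) : (mayerVietoris U V).Exact := by
  refine exact_of_degreewise_exact _ fun n ↦ (ShortComplex.moduleCat_exact_iff _).2 ?_
  intro c hc
  have hc' := (desc_apply (singularChainFunctor.map (incl U)) (singularChainFunctor.map (incl V))
    (n := n) c).symm.trans hc
  obtain ⟨w, hU, hV⟩ := exists_inter ((eq_neg_of_add_eq_zero_left hc').trans (map_neg _ _).symm)
  refine ⟨w, (lift_apply _ _ (n := n) w).trans (Eq.trans ?_ (biprod_decomp c))⟩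
  rw [hU]
  congr 2
  exact (congrArg Neg.neg hV).trans (neg_neg _)

lemma exists_eq_of_mem_smallChains {U V : Set X} {n : ℕ} {c : (singularChainFunctor.obj X).X n}
    (hc : c ∈ smallChains {U, V} n) : ∃ b, (mayerVietoris U V).g.f n b = c := by
  induction hc using Submodule.span_induction with
  | mem x h =>
    obtain ⟨σ, ⟨A, rfl | rfl, hσ⟩, rfl⟩ := h
    · refine ⟨(biprod.inl : _ ⟶ _ ⊞ singularChainFunctor.obj (TopCat.of V)).f n
        (simplex (corestrict σ hσ)), ?_⟩
      exact (ConcreteCategory.congr_hom (congr_hom (biprod.inl_desc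
        (singularChainFunctor.map (incl A)) (singularChainFunctor.map (incl V))) n) _).trans
        (map_simplex _ _)
    · refine ⟨(biprod.inr : _ ⟶ singularChainFunctor.obj (TopCat.of U) ⊞ _).f n
        (simplex (corestrict σ hσ)), ?_⟩
      exact (ConcreteCategory.congr_hom (congr_hom (biprod.inr_desc
        (singularChainFunctor.map (incl U)) (singularChainFunctor.map (incl A))) n) _).trans
        (map_simplex _ _)
  | zero => exact ⟨0, map_zero _⟩
  | add x y _ _ hx hy =>
    obtain ⟨a, rfl⟩ := hx
    obtain ⟨b, rfl⟩ := hy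
    exact ⟨a + b, map_add _ _ _⟩
  | smul z x _ hx =>
    obtain ⟨a, rfl⟩ := hx
    exact ⟨z • a, map_zsmul _ _ _⟩

lemma map_incl_mem_smallChains {s : Set (Set X)} {U : Set X} (hU : U ∈ s) {n : ℕ}
    (x : (singularChainFunctor.obj (TopCat.of U)).X n) :
    (singularChainFunctor.map (incl U)).f n x ∈ smallChains s n := by
  have hx : x ∈ Submodule.span ℤ (Set.range fun σ : SingularSimplex U n ↦
      simplex (X := TopCat.of U) σ) := by
    exact (span_simplex (TopCat.of U) n).symm ▸ Submodule.mem_top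
  induction hx using Submodule.span_induction with
  | mem x h =>
    obtain ⟨σ, rfl⟩ := h
    rw [map_simplex]
    refine simplex_mem_smallChains hU ?_
    rintro _ ⟨t, rfl⟩
    exact (σ t).2
  | zero => rw [map_zero]; exact Submodule.zero_mem _
  | add x y _ _ hx hy => rw [map_add]; exact Submodule.add_mem _ hx hy
  | smul a x _ hx => rw [map_smul]; exact Submodule.smul_mem _ _ hx

lemma mayerVietoris_g_mem_smallChains {U V : Set X} {n : ℕ} (c : (mayerVietoris U V).X₂.X n) :
    (show (singularChainFunctor.obj X).X n from (mayerVietoris U V).g.f n c) ∈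
      smallChains {U, V} n := by
  have := desc_apply (singularChainFunctor.map (incl U)) (singularChainFunctor.map (incl V))
    (n := n) c
  refine this ▸ Submodule.add_mem _ (map_incl_mem_smallChains (by simp) _)
    (map_incl_mem_smallChains (by simp) _)

lemma mayerVietoris_isLiftable {U V : Set X} (hU : IsOpen U) (hV : IsOpen V)
    (h : U ∪ V = Set.univ) : ChainComplex.IsLiftable (mayerVietoris U V) := by
  intro n c hc
  obtain ⟨e, he⟩ := exists_sub_d_mem_smallChains (s := {U, V})
    (by rintro _ (rfl | rfl) <;> assumption) (by simpa using h) c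
    fun m hm ↦ by
      obtain ⟨b, hb⟩ := hc m hm
      have := mayerVietoris_g_mem_smallChains b
      exact hb ▸ this
  exact ⟨e, exists_eq_of_mem_smallChains he⟩

end SingularChain

namespace SingularChain

open Limits HomologicalComplex

variable {X Y Z : TopCat.{0}}

/-- The linear map induced on singular homology. -/
noncomputable def homologyMap (f : X ⟶ Y) (p : ℕ) :
    singularHomology X p →ₗ[ℤ] singularHomology Y p :=
  (HomologicalComplex.homologyMap (singularChainFunctor.map f) p).hom

lemma homologyMap_id (X : TopCat.{0}) (p : ℕ) : homologyMap (𝟙 X) p = LinearMap.id :=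
  congrArg ModuleCat.Hom.hom
    (((singularChainFunctor ⋙ homologyFunctor _ _ p : TopCat.{0} ⥤ ModuleCat.{0} ℤ)).map_id X)

lemma homologyMap_comp (f : X ⟶ Y) (g : Y ⟶ Z) (p : ℕ) :
    homologyMap (f ≫ g) p = homologyMap g p ∘ₗ homologyMap f p :=
  congrArg ModuleCat.Hom.hom
    (((singularChainFunctor ⋙ homologyFunctor _ _ p : TopCat.{0} ⥤ ModuleCat.{0} ℤ)).map_comp f g)

lemma homologyMap_eq_of_homotopy {f g : X ⟶ Y} (H : ContinuousMap.Homotopy f.hom g.hom) (p : ℕ) :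
    homologyMap f p = homologyMap g p := by
  let H' : TopCat.Homotopy f g := H
  have := ((H'.toSSet.toSimplicialObjectHomotopy.whiskerRight
    (ModuleCat.free ℤ)).toChainHomotopy).homologyMap_eq p
  exact congrArg ModuleCat.Hom.hom this

lemma homologyMap_bijective_of_homotopy {f : X ⟶ Y} {g : Y ⟶ X}
    (H : ContinuousMap.Homotopy (f ≫ g).hom (𝟙 X : X ⟶ X).hom)
    (H' : ContinuousMap.Homotopy (g ≫ f).hom (𝟙 Y : Y ⟶ Y).hom) (p : ℕ) :
    Function.Bijective (homologyMap f p) := by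
  have h := homologyMap_eq_of_homotopy H p
  have h' := homologyMap_eq_of_homotopy H' p
  rw [homologyMap_comp, homologyMap_id] at h h'
  exact Function.bijective_iff_has_inverse.2
    ⟨homologyMap g p, fun x ↦ LinearMap.congr_fun h x, fun x ↦ LinearMap.congr_fun h' x⟩

section TotallyDisconnected

variable (X) [TotallyDisconnectedSpace X]

/-- The singular chain complex of a totally disconnected space. -/
noncomputable def isoOfTotallyDisconnected : singularChainFunctor.obj X ≅
    ChainComplex.alternatingConst.obj ((ModuleCat.free ℤ).obj X) :=
  (AlgebraicTopology.alternatingFaceMapComplex _).mapIso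
    (((SimplicialObject.whiskering _ _).obj _).mapIso
    (TopCat.toSSetIsoConst X) ≪≫ Functor.constComp _ _ _) ≪≫
    AlgebraicTopology.alternatingFaceMapComplexConst.app _

lemma bettiNumber_succ_of_totallyDisconnected (p : ℕ) : bettiNumber X (p + 1) = 0 := by
  have h : (singularChainFunctor.obj X).ExactAt (p + 1) :=
    .of_iso (ChainComplex.alternatingConst_exactAt _ _ (by simp)) (isoOfTotallyDisconnected X).symm
  have := ModuleCat.subsingleton_of_isZero h.isZero_homology
  exact rank_subsingleton' ℤ ((singularChainFunctor.obj X).homology (p + 1))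

lemma bettiNumber_zero_of_totallyDisconnected : bettiNumber X 0 = Cardinal.mk X := by
  let e : (singularChainFunctor.obj X).homology 0 ≅ (ModuleCat.free ℤ).obj X :=
    (homologyFunctor _ _ 0).mapIso (isoOfTotallyDisconnected X) ≪≫
      ChainComplex.alternatingConstHomologyZero _
  refine e.toLinearEquiv.rank_eq.trans ?_
  change Module.rank ℤ (X →₀ ℤ) = _
  simp

lemma subsingleton_singularHomology_of_isEmpty (X : TopCat.{0}) [IsEmpty X] (p : ℕ) :
    Subsingleton (singularHomology X p) := by
  cases p with
  | zero =>
    let e : (singularChainFunctor.obj X).homology 0 ≅ (ModuleCat.free ℤ).obj X :=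
      (homologyFunctor _ _ 0).mapIso (isoOfTotallyDisconnected X) ≪≫
        ChainComplex.alternatingConstHomologyZero _
    have : Subsingleton ((ModuleCat.free ℤ).obj X) :=
      inferInstanceAs (Subsingleton (X →₀ ℤ))
    exact e.toLinearEquiv.toEquiv.subsingleton
  | succ p =>
    have h : (singularChainFunctor.obj X).ExactAt (p + 1) :=
      .of_iso (ChainComplex.alternatingConst_exactAt _ _ (by simp))
        (isoOfTotallyDisconnected X).symm
    exact ModuleCat.subsingleton_of_isZero h.isZero_homology

end TotallyDisconnected

section MayerVietoris

variable (U V : Set X)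

lemma homologyMap_comp_apply {A B C : ChainComplex (ModuleCat.{0} ℤ) ℕ} (f : A ⟶ B) (g : B ⟶ C)
    (h : A ⟶ C) (w : f ≫ g = h) {p : ℕ} (x : A.homology p) :
    HomologicalComplex.homologyMap g p (HomologicalComplex.homologyMap f p x) =
      HomologicalComplex.homologyMap h p x := by
  rw [← w, HomologicalComplex.homologyMap_comp]
  rfl

lemma homologyMap_add_apply {A B : ChainComplex (ModuleCat.{0} ℤ) ℕ} (f g : A ⟶ B)
    {p : ℕ} (x : A.homology p) : HomologicalComplex.homologyMap (f + g) p x =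
      HomologicalComplex.homologyMap f p x + HomologicalComplex.homologyMap g p x := by
  rw [HomologicalComplex.homologyMap_add]
  rfl

lemma homologyMap_zero_apply {A B : ChainComplex (ModuleCat.{0} ℤ) ℕ}
    {p : ℕ} (x : A.homology p) : HomologicalComplex.homologyMap (0 : A ⟶ B) p x = 0 := by
  rw [HomologicalComplex.homologyMap_zero]
  rfl

lemma homologyMap_id_apply {A : ChainComplex (ModuleCat.{0} ℤ) ℕ}
    {p : ℕ} (x : A.homology p) : HomologicalComplex.homologyMap (𝟙 A) p x = x := by
  rw [HomologicalComplex.homologyMap_id]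
  rfl

lemma homologyMap_neg_apply {A B : ChainComplex (ModuleCat.{0} ℤ) ℕ} (f : A ⟶ B)
    {p : ℕ} (x : A.homology p) : HomologicalComplex.homologyMap (-f) p x =
      -HomologicalComplex.homologyMap f p x := by
  rw [HomologicalComplex.homologyMap_neg]
  rfl

/-- The product module structure, preferred to the one given by the additive group structure. -/
noncomputable instance instModuleProd (M N : ModuleCat.{0} ℤ) : Module ℤ (M × N) := Prod.instModule

/-- The homology of a direct sum of chain complexes. -/
noncomputable def homologyBiprod (A B : ChainComplex (ModuleCat.{0} ℤ) ℕ) (p : ℕ) :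
    (A ⊞ B).homology p ≃ₗ[ℤ] A.homology p × B.homology p where
  toLinearMap := (HomologicalComplex.homologyMap (biprod.fst : A ⊞ B ⟶ A) p).hom.prod
    (HomologicalComplex.homologyMap (biprod.snd : A ⊞ B ⟶ B) p).hom
  invFun x := HomologicalComplex.homologyMap (biprod.inl : A ⟶ A ⊞ B) p x.1 +
    HomologicalComplex.homologyMap (biprod.inr : B ⟶ A ⊞ B) p x.2
  left_inv x := by
    refine Eq.trans (congrArg₂ _ (homologyMap_comp_apply _ _ _ rfl x)
      (homologyMap_comp_apply _ _ _ rfl x)) ?_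
    rw [← homologyMap_add_apply, biprod.total, homologyMap_id_apply]
  right_inv x := by
    refine Prod.ext ((map_add _ _ _).trans ?_) ((map_add _ _ _).trans ?_)
    · refine Eq.trans (congrArg₂ _ (homologyMap_comp_apply _ _ _ biprod.inl_fst x.1)
        (homologyMap_comp_apply _ _ _ biprod.inr_fst x.2)) ?_
      rw [homologyMap_id_apply, homologyMap_zero_apply, add_zero]
    · refine Eq.trans (congrArg₂ _ (homologyMap_comp_apply _ _ _ biprod.inl_snd x.1)
        (homologyMap_comp_apply _ _ _ biprod.inr_snd x.2)) ?_
      rw [homologyMap_id_apply, homologyMap_zero_apply, zero_add]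

/-- The first map of the Mayer–Vietoris sequence. -/
noncomputable def mayerVietorisInter (p : ℕ) : singularHomology (TopCat.of (U ∩ V : Set X)) p →ₗ[ℤ]
    singularHomology (TopCat.of U) p × singularHomology (TopCat.of V) p :=
  (homologyMap (inclOfLE Set.inter_subset_left) p).prod
    (-homologyMap (inclOfLE Set.inter_subset_right) p)

/-- The second map of the Mayer–Vietoris sequence. -/
noncomputable def mayerVietorisUnion (p : ℕ) :
    singularHomology (TopCat.of U) p × singularHomology (TopCat.of V) p →ₗ[ℤ]
      singularHomology X p :=
  (homologyMap (incl U) p).coprod (homologyMap (incl V) p)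

/-- The homology of the middle term of the Mayer–Vietoris sequence. -/
noncomputable def mayerVietorisMiddle (p : ℕ) : (mayerVietoris U V).X₂.homology p ≃ₗ[ℤ]
    singularHomology (TopCat.of U) p × singularHomology (TopCat.of V) p :=
  homologyBiprod (singularChainFunctor.obj (TopCat.of U)) (singularChainFunctor.obj (TopCat.of V)) p

lemma mayerVietorisMiddle_f (p : ℕ) (x : (mayerVietoris U V).X₁.homology p) :
    mayerVietorisMiddle U V p (HomologicalComplex.homologyMap (mayerVietoris U V).f p x) =
      mayerVietorisInter U V p x := by
  refine Prod.ext (homologyMap_comp_apply _ _ _ (biprod.lift_fst _ _) x) ?_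
  refine (homologyMap_comp_apply _ _ _ (biprod.lift_snd _ _) x).trans ?_
  exact homologyMap_neg_apply _ x

lemma homologyMap_g_symm (p : ℕ)
    (x : singularHomology (TopCat.of U) p × singularHomology (TopCat.of V) p) :
    HomologicalComplex.homologyMap (mayerVietoris U V).g p ((mayerVietorisMiddle U V p).symm x) =
      mayerVietorisUnion U V p x := by
  refine (map_add (HomologicalComplex.homologyMap (mayerVietoris U V).g p).hom _ _).trans ?_
  exact congrArg₂ _ (homologyMap_comp_apply _ _ _ (biprod.inl_desc _ _) x.1)
    (homologyMap_comp_apply _ _ _ (biprod.inr_desc _ _) x.2)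

variable {U V}

theorem mayerVietoris_homology_exact (hU : IsOpen U) (hV : IsOpen V) (h : U ∪ V = Set.univ)
    (p : ℕ) :
    Function.Exact (mayerVietorisInter U V p) (mayerVietorisUnion U V p) := by
  have := ChainComplex.homology_exact_of_isLiftable (mayerVietoris_exact U V)
    (mayerVietoris_isLiftable hU hV h) p
  intro x
  rw [← homologyMap_g_symm]
  refine (this _).trans (exists_congr fun y ↦ ?_)
  rw [LinearEquiv.eq_symm_apply]
  exact iff_of_eq (congrArg (· = x) (mayerVietorisMiddle_f U V p y))

theorem mayerVietoris_homology_surjective (hU : IsOpen U) (hV : IsOpen V) (h : U ∪ V = Set.univ) :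
    Function.Surjective (mayerVietorisUnion U V 0) := by
  intro x
  obtain ⟨y, rfl⟩ := ChainComplex.homologyMap_surjective_of_isLiftable
    (mayerVietoris_isLiftable hU hV h) x
  refine ⟨mayerVietorisMiddle U V 0 y, (homologyMap_g_symm U V 0 _).symm.trans ?_⟩
  rw [LinearEquiv.symm_apply_apply]

theorem exists_mayerVietoris_connecting (hU : IsOpen U) (hV : IsOpen V) (h : U ∪ V = Set.univ)
    (p : ℕ) :
    ∃ δ : singularHomology X (p + 1) →ₗ[ℤ] singularHomology (TopCat.of (U ∩ V : Set X)) p,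
      Function.Exact (mayerVietorisUnion U V (p + 1)) δ ∧
        Function.Exact δ (mayerVietorisInter U V p) := by
  obtain ⟨δ, h1, h2⟩ := ChainComplex.exists_connecting_of_isLiftable (mayerVietoris_exact U V)
    (mayerVietoris_isLiftable hU hV h) p
  refine ⟨δ, fun x ↦ (h1 x).trans ⟨?_, ?_⟩, fun x ↦ Iff.trans ?_ (h2 x)⟩
  · rintro ⟨y, rfl⟩
    refine ⟨mayerVietorisMiddle U V (p + 1) y, (homologyMap_g_symm U V _ _).symm.trans ?_⟩
    rw [LinearEquiv.symm_apply_apply]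
  · rintro ⟨y, rfl⟩
    exact ⟨_, homologyMap_g_symm U V _ y⟩
  · exact (iff_of_eq (congrArg (· = 0) (mayerVietorisMiddle_f U V p x).symm)).trans
      (LinearEquiv.map_eq_zero_iff _)

end MayerVietoris

end SingularChain

lemma Cardinal.eq_natCast_sub_of_add_eq {c : Cardinal.{0}} {m n : ℕ} (h : c + m = n) :
    c = (n - m : ℕ) := by
  have hc : c ≤ n := h ▸ self_le_add_right c m
  lift c to ℕ using hc.trans_lt (natCast_lt_aleph0)
  norm_cast at h ⊢
  omega

section Rank

variable {R : Type} [CommRing R] [IsDomain R] {W U V Y X : Type}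
  [AddCommGroup W] [AddCommGroup U] [AddCommGroup V] [AddCommGroup Y] [AddCommGroup X]
  [Module R W] [Module R U] [Module R V] [Module R Y] [Module R X]
  {jU : W →ₗ[R] U} {jV : W →ₗ[R] V} {f : U →ₗ[R] Y} {g : V →ₗ[R] Y}
  {β γ : ℕ}

lemma rank_prod_of_isDomain : Module.rank R (U × V) = Module.rank R U + Module.rank R V := by
  rw [← (LinearMap.fst R U V).rank_range_add_rank_ker, LinearMap.ker_fst,
    rank_range_of_surjective _ LinearMap.fst_surjective,
    ← (LinearEquiv.ofInjective _ (LinearMap.inr_injective (R := R) (M := U) (M₂ := V))).rank_eq]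

lemma rank_ker_prod_neg (hf : Function.Injective f) (hg : Function.Injective g)
    (h : f ∘ₗ jU = g ∘ₗ jV)
    (hs : Function.Surjective (f ∘ₗ jU)) (hY : Module.rank R Y = β) (hW : Module.rank R W = γ) :
    Module.rank R (LinearMap.ker (jU.prod (-jV))) = (γ - β : ℕ) := by
  have hker : LinearMap.ker (jU.prod (-jV)) = LinearMap.ker (f ∘ₗ jU) := by
    ext x
    have h1 : f (jU x) = 0 ↔ jU x = 0 := map_eq_zero_iff f hf
    have h2 : g (jV x) = 0 ↔ jV x = 0 := map_eq_zero_iff g hg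
    have h3 : f (jU x) = g (jV x) := LinearMap.congr_fun h x
    change (jU x, -jV x) = 0 ↔ f (jU x) = 0
    rw [Prod.mk_eq_zero, neg_eq_zero, ← h1, ← h2, ← h3, and_self]
  rw [hker]
  apply Cardinal.eq_natCast_sub_of_add_eq
  rw [← hW, ← (f ∘ₗ jU).rank_range_add_rank_ker, rank_range_of_surjective _ hs, hY, add_comm]

lemma rank_range_of_exact_prod_neg {b : U × V →ₗ[R] X} (hf : Function.Bijective f)
    (hg : Function.Bijective g)
    (h : f ∘ₗ jU = g ∘ₗ jV) (hs : Function.Surjective (f ∘ₗ jU)) (hY : Module.rank R Y = β)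
    (hW : Module.rank R W = γ) (hb : Function.Exact (jU.prod (-jV)) b) :
    Module.rank R (LinearMap.range b) = β := by
  have hle : β ≤ γ := by
    have := (f ∘ₗ jU).rank_le_of_surjective hs
    rw [hY, hW] at this
    exact_mod_cast this
  have h1 := b.rank_range_add_rank_ker
  have h2 := (jU.prod (-jV)).rank_range_add_rank_ker
  rw [rank_ker_prod_neg hf.1 hg.1 h hs hY hW, hW, ← LinearMap.exact_iff.1 hb] at h2
  rw [rank_prod_of_isDomain, (LinearEquiv.ofBijective f hf).rank_eq, (LinearEquiv.ofBijective g hg).rank_eq,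
    hY] at h1
  have h3 := Cardinal.eq_natCast_sub_of_add_eq h2
  rw [h3, ← Nat.cast_add] at h1
  rw [Cardinal.eq_natCast_sub_of_add_eq h1]
  congr 1
  omega

lemma rank_eq_of_exact {b : U →ₗ[R] X} {δ : X →ₗ[R] W} {c : W →ₗ[R] V}
    (h1 : Function.Exact b δ) (h2 : Function.Exact δ c) :
    Module.rank R X = Module.rank R (LinearMap.ker c) + Module.rank R (LinearMap.range b) := by
  rw [LinearMap.exact_iff.1 h2, ← LinearMap.exact_iff.1 h1, δ.rank_range_add_rank_ker]

end Rank

namespace SingularChain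

variable {X Y : TopCat.{0}} {U V : Set X}

theorem bettiNumber_of_disjoint (hU : IsOpen U) (hV : IsOpen V) (h : U ∪ V = Set.univ)
    (hd : U ∩ V = ∅) (p : ℕ) :
    bettiNumber X p = bettiNumber (TopCat.of U) p + bettiNumber (TopCat.of V) p := by
  have hempty : IsEmpty (U ∩ V : Set X) := by rw [hd]; infer_instance
  have hz (q : ℕ) : ∀ x : singularHomology (TopCat.of (U ∩ V : Set X)) q, x = 0 := fun x ↦
    (subsingleton_singularHomology_of_isEmpty (TopCat.of (U ∩ V : Set X)) q).elim x 0
  have hinj : Function.Injective (mayerVietorisUnion U V p) := by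
    rw [injective_iff_map_eq_zero]
    intro x hx
    obtain ⟨w, rfl⟩ := (mayerVietoris_homology_exact hU hV h p x).1 hx
    rw [hz p w, map_zero]
  have hsurj : Function.Surjective (mayerVietorisUnion U V p) := by
    cases p with
    | zero => exact mayerVietoris_homology_surjective hU hV h
    | succ p =>
      obtain ⟨δ, h1, -⟩ := exists_mayerVietoris_connecting hU hV h p
      exact fun x ↦ (h1 x).1 (hz p _)
  exact (LinearEquiv.ofBijective _ ⟨hinj, hsurj⟩).rank_eq.symm.trans rank_prod_of_isDomain

theorem bettiNumber_of_cover (hU : IsOpen U) (hV : IsOpen V) (h : U ∪ V = Set.univ)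
    (π : X ⟶ Y) (hπU : ∀ p, Function.Bijective (homologyMap (incl U ≫ π) p))
    (hπV : ∀ p, Function.Bijective (homologyMap (incl V ≫ π) p))
    (s : Y ⟶ TopCat.of (U ∩ V : Set X)) (hs : s ≫ incl _ ≫ π = 𝟙 Y) {β γ : ℕ → ℕ}
    (hβ : ∀ p, bettiNumber Y p = β p)
    (hγ : ∀ p, bettiNumber (TopCat.of (U ∩ V : Set X)) p = γ p) :
    bettiNumber X 0 = β 0 ∧ ∀ p, bettiNumber X (p + 1) = (γ p - β p + β (p + 1) : ℕ) := by
  have hcomm (p : ℕ) : homologyMap (incl U ≫ π) p ∘ₗ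
      homologyMap (inclOfLE (Set.inter_subset_left (s := U) (t := V))) p =
      homologyMap (incl V ≫ π) p ∘ₗ
        homologyMap (inclOfLE (Set.inter_subset_right (s := U) (t := V))) p := by
    rw [← homologyMap_comp, ← homologyMap_comp]
    rfl
  have hsurj (p : ℕ) : Function.Surjective (homologyMap (incl U ≫ π) p ∘ₗ
      homologyMap (inclOfLE (Set.inter_subset_left (s := U) (t := V))) p) := by
    rw [← homologyMap_comp]
    refine Function.RightInverse.surjective (g := homologyMap s p) fun y ↦ ?_
    have : homologyMap (s ≫ incl _ ≫ π) p y = y := by rw [hs, homologyMap_id]; rfl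
    rw [homologyMap_comp] at this
    exact this
  have hrange (p : ℕ) :=
    rank_range_of_exact_prod_neg (hπU p) (hπV p) (hcomm p) (hsurj p) (hβ p) (hγ p)
      (mayerVietoris_homology_exact hU hV h p)
  have hker (p : ℕ) :=
    rank_ker_prod_neg (hπU p).1 (hπV p).1 (hcomm p) (hsurj p) (hβ p) (hγ p)
  refine ⟨?_, fun p ↦ ?_⟩
  · exact (rank_range_of_surjective _
      (mayerVietoris_homology_surjective hU hV h)).symm.trans (hrange 0)
  · obtain ⟨δ, h1, h2⟩ := exists_mayerVietoris_connecting hU hV h p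
    rw [Nat.cast_add]
    exact (rank_eq_of_exact h1 h2).trans (congrArg₂ (· + ·) (hker p) (hrange (p + 1)))

end SingularChain

namespace SingularChain

section Contractible

variable {X Y C : Type} [TopologicalSpace X] [TopologicalSpace Y] [TopologicalSpace C]

lemma homologyMap_homeomorph_bijective (e : X ≃ₜ Y) (p : ℕ) :
    Function.Bijective (homologyMap (TopCat.ofHom (e : C(X, Y))) p) := by
  refine homologyMap_bijective_of_homotopy (g := TopCat.ofHom (e.symm : C(Y, X))) ?_ ?_ p
  · exact (ContinuousMap.Homotopy.refl _).cast rfl (by ext x; exact e.symm_apply_apply x)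
  · exact (ContinuousMap.Homotopy.refl _).cast rfl (by ext x; exact e.apply_symm_apply x)

lemma bettiNumber_eq_of_homeomorph (e : X ≃ₜ Y) (p : ℕ) :
    bettiNumber (TopCat.of X) p = bettiNumber (TopCat.of Y) p :=
  (LinearEquiv.ofBijective _ (homologyMap_homeomorph_bijective e p)).rank_eq

/-- The projection of a product to its first factor. -/
def fst (Y C : Type) [TopologicalSpace Y] [TopologicalSpace C] :
    TopCat.of (Y × C) ⟶ TopCat.of Y :=
  TopCat.ofHom ⟨Prod.fst, continuous_fst⟩

lemma homologyMap_fst_bijective [ContractibleSpace C] (p : ℕ) :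
    Function.Bijective (homologyMap (fst Y C) p) := by
  obtain ⟨c, ⟨H⟩⟩ := id_nullhomotopic C
  refine homologyMap_bijective_of_homotopy
    (g := TopCat.ofHom ⟨fun y ↦ (y, c), by fun_prop⟩) ?_ ?_ p
  · exact ((ContinuousMap.Homotopy.refl (ContinuousMap.id Y)).prodMap H.symm).cast rfl rfl
  · exact ContinuousMap.Homotopy.refl _

lemma homologyMap_bijective_of_eq_fst [ContractibleSpace C] (e : X ≃ₜ Y × C)
    (f : TopCat.of X ⟶ TopCat.of Y) (hf : ∀ x, f x = (e x).1) (p : ℕ) :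
    Function.Bijective (homologyMap f p) := by
  have : f = TopCat.ofHom (e : C(X, Y × C)) ≫ fst Y C := by ext x; exact hf x
  rw [this, homologyMap_comp, LinearMap.coe_comp]
  exact (homologyMap_fst_bijective p).comp (homologyMap_homeomorph_bijective e p)

lemma bettiNumber_prod_contractible [ContractibleSpace C] (p : ℕ) :
    bettiNumber (TopCat.of (Y × C)) p = bettiNumber (TopCat.of Y) p :=
  (LinearEquiv.ofBijective _ (homologyMap_fst_bijective p)).rank_eq

/-- A part of a product with a subset, cut out by a condition on the second factor. -/
def prodSubtypeHomeomorph {E : Type} [TopologicalSpace E] {S T : Set E} {U : Set (Y × S)}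
    (hU : ∀ z, z ∈ U ↔ (z.2 : E) ∈ T) (hT : T ⊆ S) : U ≃ₜ Y × T where
  toFun z := (z.1.1, ⟨z.1.2, (hU _).1 z.2⟩)
  invFun w := ⟨(w.1, ⟨w.2, hT w.2.2⟩), (hU _).2 w.2.2⟩
  left_inv _ := rfl
  right_inv _ := rfl

end Contractible

variable {Y : Type} [TopologicalSpace Y]

lemma bettiNumber_prod_diff (A : Finset ℝ) : ∀ {J : Set ℝ}, IsOpen J → Convex ℝ J → J.Nonempty →
    (A : Set ℝ) ⊆ J → ∀ p, bettiNumber (TopCat.of (Y × (J \ A : Set ℝ))) p =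
      (A.card + 1) * bettiNumber (TopCat.of Y) p := by
  induction A using Finset.induction_on_max with
  | empty =>
    intro J hJ hc hne _ p
    have : ContractibleSpace (J \ (∅ : Finset ℝ) : Set ℝ) := by
      rw [Finset.coe_empty, Set.sdiff_empty]
      exact hc.contractibleSpace hne
    rw [bettiNumber_prod_contractible]
    simp
  | insert a A ha ih =>
    intro J hJ hc hne hA p
    have haJ : a ∈ J := hA (by simp)
    obtain ⟨ε, hε, hball⟩ := Metric.isOpen_iff.1 hJ a haJ
    let U : Set (Y × (J \ (insert a A : Finset ℝ) : Set ℝ)) := {z | (z.2 : ℝ) < a}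
    let V : Set (Y × (J \ (insert a A : Finset ℝ) : Set ℝ)) := {z | a < (z.2 : ℝ)}
    have hU : IsOpen U := isOpen_lt (by fun_prop) (by fun_prop)
    have hV : IsOpen V := isOpen_lt (by fun_prop) (by fun_prop)
    have hUV : U ∪ V = Set.univ := Set.eq_univ_of_forall fun z ↦
      lt_or_gt_of_ne (a := (z.2 : ℝ)) (b := a) fun h ↦ z.2.2.2 (by simp [h])
    have hd : U ∩ V = ∅ := Set.eq_empty_of_forall_notMem fun z hz ↦ lt_asymm (a := (z.2 : ℝ)) (b := a) hz.1 hz.2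
    refine (bettiNumber_of_disjoint (X := TopCat.of (Y × (J \ (insert a A : Finset ℝ) : Set ℝ)))
      hU hV hUV hd p).trans ?_
    have e1 : U ≃ₜ Y × ((J ∩ Set.Iio a) \ A : Set ℝ) := by
      refine prodSubtypeHomeomorph (fun z ↦ ⟨fun h ↦ ⟨⟨z.2.2.1, h⟩, fun h' ↦ z.2.2.2 ?_⟩,
        fun h ↦ h.1.2⟩) fun x hx ↦ ⟨hx.1.1, fun h ↦ ?_⟩
      · simpa using Or.inr h'
      · rcases Finset.mem_insert.1 h with h | h
        · exact hx.1.2.ne h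
        · exact hx.2 h
    have e2 : V ≃ₜ Y × (J ∩ Set.Ioi a : Set ℝ) := by
      refine prodSubtypeHomeomorph (fun z ↦ ⟨fun h ↦ ⟨z.2.2.1, h⟩, fun h ↦ h.2⟩)
        fun x hx ↦ ⟨hx.1, fun h ↦ ?_⟩
      rcases Finset.mem_insert.1 h with h | h
      · exact hx.2.ne' h
      · exact lt_asymm hx.2 (ha x h)
    have : ContractibleSpace (J ∩ Set.Ioi a : Set ℝ) :=
      (hc.inter (convex_Ioi a)).contractibleSpace ⟨a + ε / 2, hball (by
        rw [Metric.mem_ball, Real.dist_eq, add_sub_cancel_left, abs_of_pos] <;> linarith),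
        Set.mem_Ioi.2 (by linarith)⟩
    have h1 := ih (J := J ∩ Set.Iio a) (hJ.inter isOpen_Iio) (hc.inter (convex_Iio a))
      ⟨a - ε / 2, hball (by
        rw [Metric.mem_ball, Real.dist_eq, abs_sub_comm, sub_sub_cancel, abs_of_pos] <;> linarith),
        Set.mem_Iio.2 (by linarith)⟩
      (fun x hx ↦ ⟨hA (by simpa using Or.inr hx), ha x hx⟩) p
    refine (congrArg₂ (· + ·) ((bettiNumber_eq_of_homeomorph e1 p).trans h1)
      ((bettiNumber_eq_of_homeomorph e2 p).trans (bettiNumber_prod_contractible p))).trans ?_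
    rw [Finset.card_insert_of_notMem fun h ↦ lt_irrefl _ (ha a h)]
    push_cast
    ring

/-- The plane with finitely many points of the first coordinate axis removed. -/
def puncturedPlane (A : Finset ℝ) : Set (ℝ × ℝ) := {z | z.2 ≠ 0 ∨ z.1 ∉ A}

lemma contractibleSpace_of_convex_section {S : Set (ℝ × ℝ)} (c : ℝ) (hc : ∀ x, (x, c) ∈ S)
    (h : ∀ x y, (x, y) ∈ S → ∀ t ∈ Set.Icc (0 : ℝ) 1, (x, (1 - t) * y + t * c) ∈ S) :
    ContractibleSpace S := by
  let f : C(S, ℝ) := ⟨fun z ↦ z.1.1, by fun_prop⟩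
  let g : C(ℝ, S) := ⟨fun x ↦ ⟨(x, c), hc x⟩, by fun_prop⟩
  let H : ContinuousMap.Homotopy (ContinuousMap.id S) (g.comp f) :=
    { toFun := fun z ↦ ⟨(z.2.1.1, (1 - z.1) * z.2.1.2 + z.1 * c), h _ _ z.2.2 _ z.1.2⟩
      continuous_toFun := by fun_prop
      map_zero_left := fun x ↦ by simp
      map_one_left := fun x ↦ by simp [f, g] }
  let e : ContinuousMap.HomotopyEquiv S ℝ := ⟨f, g, ⟨H.symm⟩, ⟨ContinuousMap.Homotopy.refl _⟩⟩
  exact e.contractibleSpace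

theorem bettiNumber_prod_puncturedPlane (A : Finset ℝ) {β : ℕ → ℕ}
    (hβ : ∀ p, bettiNumber (TopCat.of Y) p = β p) :
    bettiNumber (TopCat.of (Y × puncturedPlane A)) 0 = β 0 ∧
      ∀ p, bettiNumber (TopCat.of (Y × puncturedPlane A)) (p + 1) =
        (A.card * β p + β (p + 1) : ℕ) := by
  let U₀ : Set (ℝ × ℝ) := {z | 0 < z.2 ∨ z.1 ∉ A}
  let V₀ : Set (ℝ × ℝ) := {z | z.2 < 0 ∨ z.1 ∉ A}
  let U : Set (Y × puncturedPlane A) := {z | (z.2 : ℝ × ℝ) ∈ U₀}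
  let V : Set (Y × puncturedPlane A) := {z | (z.2 : ℝ × ℝ) ∈ V₀}
  have hA : IsOpen {z : ℝ × ℝ | z.1 ∉ A} :=
    (A.finite_toSet.isClosed.isOpen_compl).preimage continuous_fst
  have hU : IsOpen U := ((isOpen_lt continuous_const continuous_snd).union hA).preimage
    (f := fun z : Y × puncturedPlane A ↦ (z.2 : ℝ × ℝ)) (by fun_prop)
  have hV : IsOpen V := ((isOpen_lt continuous_snd continuous_const).union hA).preimage
    (f := fun z : Y × puncturedPlane A ↦ (z.2 : ℝ × ℝ)) (by fun_prop)
  have hUV : U ∪ V = Set.univ := Set.eq_univ_of_forall fun z ↦ by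
    rcases z.2.2 with h | h
    · rcases lt_or_gt_of_ne h with h | h
      · exact Or.inr (Or.inl h)
      · exact Or.inl (Or.inl h)
    · exact Or.inl (Or.inr h)
  have cU : ContractibleSpace U₀ := by
    refine contractibleSpace_of_convex_section 1 (fun x ↦ Or.inl one_pos) fun x y h t ht ↦ ?_
    refine h.imp_left fun h ↦ ?_
    have := ht.1
    have := ht.2
    change 0 < y at h
    change 0 < (1 - t) * y + t * 1
    rcases ht.1.eq_or_lt with rfl | h0
    · simpa
    · nlinarith [mul_nonneg (sub_nonneg.2 ht.2) h.le]
  have cV : ContractibleSpace V₀ := by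
    refine contractibleSpace_of_convex_section (-1) (fun x ↦ Or.inl (neg_one_lt_zero))
      fun x y h t ht ↦ ?_
    refine h.imp_left fun h ↦ ?_
    change y < 0 at h
    change (1 - t) * y + t * (-1) < 0
    rcases ht.1.eq_or_lt with rfl | h0
    · simpa
    · nlinarith [mul_nonneg (sub_nonneg.2 ht.2) (neg_nonneg.2 h.le)]
  let eU : U ≃ₜ Y × U₀ := prodSubtypeHomeomorph (fun _ ↦ Iff.rfl) fun z hz ↦ hz.imp_left ne_of_gt
  let eV : V ≃ₜ Y × V₀ := prodSubtypeHomeomorph (fun _ ↦ Iff.rfl) fun z hz ↦ hz.imp_left ne_of_lt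
  have hinter (z : ℝ × ℝ) : z ∈ U₀ ∩ V₀ ↔ z.1 ∉ A :=
    ⟨fun h ↦ h.1.elim (fun h1 ↦ h.2.elim (fun h2 ↦ (lt_asymm h1 h2).elim) id) id,
      fun h ↦ ⟨Or.inr h, Or.inr h⟩⟩
  let e : (U ∩ V : Set (Y × puncturedPlane A)) ≃ₜ (Y × (Set.univ \ A : Set ℝ)) × ℝ :=
    { toFun := fun z ↦ ((z.1.1, ⟨z.1.2.1.1, trivial, (hinter _).1 z.2⟩), z.1.2.1.2)
      invFun := fun w ↦ ⟨(w.1.1, ⟨(w.1.2, w.2), Or.inr w.1.2.2.2⟩),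
        (hinter _).2 w.1.2.2.2⟩
      left_inv := fun _ ↦ rfl
      right_inv := fun _ ↦ rfl }
  obtain ⟨x₀, hx₀⟩ := Infinite.exists_notMem_finset A
  have key := bettiNumber_of_cover (X := TopCat.of (Y × puncturedPlane A)) hU hV hUV (fst Y _)
    (β := β) (γ := fun p ↦ (A.card + 1) * β p) (fun p ↦ ?_) (fun p ↦ ?_)
    (TopCat.ofHom ⟨fun y ↦ ⟨(y, ⟨(x₀, 0), Or.inr hx₀⟩), Or.inr hx₀, Or.inr hx₀⟩, by fun_prop⟩)
    rfl hβ fun p ↦ ?_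
  · refine ⟨key.1, fun p ↦ (key.2 p).trans ?_⟩
    rw [add_one_mul, Nat.add_sub_cancel]
  · exact homologyMap_bijective_of_eq_fst eU _ (fun _ ↦ rfl) p
  · exact homologyMap_bijective_of_eq_fst eV _ (fun _ ↦ rfl) p
  · refine (bettiNumber_eq_of_homeomorph e p).trans ((bettiNumber_prod_contractible p).trans ?_)
    rw [bettiNumber_prod_diff A isOpen_univ convex_univ Set.univ_nonempty (Set.subset_univ _), hβ]
    push_cast
    rfl

end SingularChain

open SingularChain

lemma Complex.exists_shear_injOn (Q : Finset ℂ) :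
    ∃ ε : ℝ, Set.InjOn (fun z : ℂ ↦ z.re + ε * z.im) Q := by
  obtain ⟨ε, hε⟩ := Infinite.exists_notMem_finset
    ((Q ×ˢ Q).image fun z ↦ -(z.1.re - z.2.re) / (z.1.im - z.2.im))
  refine ⟨ε, fun z hz w hw h ↦ ?_⟩
  have h : z.re + ε * z.im = w.re + ε * w.im := h
  have him : z.im = w.im := by
    by_contra hne
    refine hε (Finset.mem_image.2 ⟨(z, w), Finset.mk_mem_product hz hw, ?_⟩)
    rw [div_eq_iff (sub_ne_zero.2 hne)]
    linarith
  exact Complex.ext (by rw [him] at h; linarith) him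

/-- The homeomorphism between the complex and real planes given by a shear of the first
coordinate followed by subtracting a polynomial from the second one. -/
noncomputable def Complex.shearHomeomorph (ε : ℝ) (P : Polynomial ℝ) : ℂ ≃ₜ ℝ × ℝ where
  toFun z := (z.re + ε * z.im, z.im - P.eval (z.re + ε * z.im))
  invFun w := ⟨w.1 - ε * (w.2 + P.eval w.1), w.2 + P.eval w.1⟩
  left_inv z := by apply Complex.ext <;> simp
  right_inv w := by apply Prod.ext <;> simp
  continuous_toFun := by
    have := P.continuous
    fun_prop
  continuous_invFun := by
    have := P.continuous
    exact Complex.equivRealProdCLM.symm.continuous.comp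
      (f := fun w : ℝ × ℝ ↦ (w.1 - ε * (w.2 + P.eval w.1), w.2 + P.eval w.1)) (by fun_prop)

theorem Complex.exists_compl_homeomorph_puncturedPlane (Q : Finset ℂ) :
    ∃ A : Finset ℝ, A.card = Q.card ∧ Nonempty ({z : ℂ // z ∉ Q} ≃ₜ puncturedPlane A) := by
  obtain ⟨ε, hε⟩ := Complex.exists_shear_injOn Q
  let ψ : ℂ → ℝ := fun z ↦ z.re + ε * z.im
  let P := Lagrange.interpolate Q ψ Complex.im
  have hP (q : ℂ) (hq : q ∈ Q) : P.eval (ψ q) = q.im :=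
    Lagrange.eval_interpolate_at_node _ hε hq
  refine ⟨Q.image ψ, Finset.card_image_of_injOn hε,
    ⟨(Complex.shearHomeomorph ε P).subtype fun z ↦ ?_⟩⟩
  change z ∉ Q ↔ z.im - P.eval (ψ z) ≠ 0 ∨ ψ z ∉ Q.image ψ
  rw [ne_eq, ← not_and_or, not_iff_not]
  constructor
  · exact fun hz ↦ ⟨by rw [hP z hz, sub_self], Finset.mem_image_of_mem _ hz⟩
  · rintro ⟨h1, h2⟩
    obtain ⟨q, hq, hqz⟩ := Finset.mem_image.1 h2
    rw [← hqz, hP q hq, sub_eq_zero] at h1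
    have h3 : q.re + ε * q.im = z.re + ε * z.im := hqz
    rw [h1] at h3
    rwa [show z = q from Complex.ext (by linarith) h1]

lemma Complex.bettiNumber_ne_zero (p : ℕ) :
    bettiNumber (TopCat.of {z : ℂ // z ≠ 0}) p = (if p ≤ 1 then 1 else 0 : ℕ) := by
  obtain ⟨A, hA, ⟨e⟩⟩ := Complex.exists_compl_homeomorph_puncturedPlane {0}
  let e' : {z : ℂ // z ≠ 0} ≃ₜ Unit × puncturedPlane A :=
    ((Homeomorph.refl ℂ).subtype fun z ↦ by simp).trans (e.trans (Homeomorph.punitProd _).symm)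
  have h := bettiNumber_prod_puncturedPlane (Y := Unit) A
    (β := fun p ↦ if p = 0 then 1 else 0) (fun p ↦ by
      cases p with
      | zero => exact (bettiNumber_zero_of_totallyDisconnected (TopCat.of Unit)).trans (by simp)
      | succ p => exact (bettiNumber_succ_of_totallyDisconnected (TopCat.of Unit) p).trans (by simp))
  rw [bettiNumber_eq_of_homeomorph e']
  rcases p with - | - | p
  · simpa using h.1
  · simpa [hA] using h.2 0
  · simpa using h.2 (p + 1)

section Arrangement

lemma LinearMap.exists_dual_basis_of_ne_zero {a : (Fin 2 → ℂ) →ₗ[ℂ] ℂ} (ha : a ≠ 0) :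
    ∃ (e k : Fin 2 → ℂ) (l : (Fin 2 → ℂ) →ₗ[ℂ] ℂ), a e = 1 ∧ a k = 0 ∧ l e = 0 ∧ l k = 1 ∧
      ∀ z, a z • e + l z • k = z := by
  obtain ⟨x, y, hxy⟩ : ∃ x y : ℂ, ∀ z, a z = x * z 0 + y * z 1 := by
    refine ⟨a (Pi.single 0 1), a (Pi.single 1 1), fun z ↦ ?_⟩
    have h : z = z 0 • Pi.single 0 1 + z 1 • Pi.single 1 1 := by
      ext i
      fin_cases i <;> simp
    conv_lhs => rw [h]
    simp [mul_comm]
  by_cases hx : x = 0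
  · have hy : y ≠ 0 := by
      rintro rfl
      exact ha (LinearMap.ext fun z ↦ by simp [hxy, hx])
    refine ⟨![0, y⁻¹], ![1, 0], LinearMap.proj 0, ?_, ?_, ?_, ?_, fun z ↦ ?_⟩
    all_goals try simp [hxy, hx, hy]
    ext i
    fin_cases i <;> simp
    field_simp
  · refine ⟨![x⁻¹, 0], ![-y / x, 1], LinearMap.proj 1, ?_, ?_, ?_, ?_, fun z ↦ ?_⟩
    all_goals try simp [hxy, hx]
    · field_simp
      ring
    · ext i
      fin_cases i <;> simp
      field_simp
      ring

theorem exists_homeomorph_arrangement_complement {m : ℕ} {α : Fin (m + 1) → ((Fin 2 → ℂ) →ₗ[ℂ] ℂ)}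
    (hα : α 0 ≠ 0) (hind : ∀ i j, i ≠ j → ∀ c : ℂ, α i ≠ c • α j) :
    ∃ Q : Finset ℂ, Q.card = m ∧
      Nonempty ({z : Fin 2 → ℂ // (∏ i, α i z) ≠ 0} ≃ₜ {z : ℂ // z ≠ 0} × {z : ℂ // z ∉ Q}) := by
  obtain ⟨e, k, l, hae, hak, hle, hlk, hz⟩ := LinearMap.exists_dual_basis_of_ne_zero hα
  have hdecomp (i : Fin (m + 1)) (z : Fin 2 → ℂ) : α i z = α 0 z * α i e + l z * α i k := by
    conv_lhs => rw [← hz z]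
    simp
  have hk (i : Fin m) : α i.succ k ≠ 0 := fun h ↦
    hind i.succ 0 (Fin.succ_ne_zero i) (α i.succ e) (LinearMap.ext fun z ↦ by
      rw [hdecomp, h]
      simp [mul_comm])
  let q : Fin m → ℂ := fun i ↦ -α i.succ e / α i.succ k
  have hq : Function.Injective q := fun i j hij ↦ by
    by_contra hne
    refine hind i.succ j.succ ((Fin.succ_injective m).ne hne) (α i.succ k / α j.succ k)
      (LinearMap.ext fun z ↦ ?_)
    have h1 := hk i
    have h2 := hk j
    change -α i.succ e / α i.succ k = -α j.succ e / α j.succ k at hij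
    rw [div_eq_div_iff h1 h2] at hij
    rw [LinearMap.smul_apply, smul_eq_mul, hdecomp, hdecomp j.succ z]
    field_simp
    linear_combination -α 0 z * hij
  let Q : Finset ℂ := Finset.univ.image q
  have hM (z : Fin 2 → ℂ) : (∏ i, α i z) ≠ 0 ↔ α 0 z ≠ 0 ∧ l z / α 0 z ∉ Q := by
    rw [Fin.prod_univ_succ, mul_ne_zero_iff, Finset.prod_ne_zero_iff]
    refine and_congr_right fun h0 ↦ ?_
    simp only [Q, Finset.mem_image, Finset.mem_univ, true_and, true_imp_iff, not_exists]
    refine forall_congr' fun i ↦ not_iff_not.2 ?_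
    have := hk i
    rw [hdecomp, div_eq_div_iff (hk i) h0]
    constructor <;> intro h <;> linear_combination -h
  have hM' (u w : ℂ) : α 0 (u • (e + w • k)) = u ∧ l (u • (e + w • k)) = u * w := by
    simp [hae, hak, hle, hlk]
  have hcont (a : (Fin 2 → ℂ) →ₗ[ℂ] ℂ) : Continuous a := a.continuous_of_finiteDimensional
  have hc0 := hcont (α 0)
  have hcl := hcont l
  refine ⟨Q, by simp [Q, Finset.card_image_of_injective _ hq], ⟨?_⟩⟩
  exact
    { toFun := fun z ↦ (⟨α 0 z, ((hM z).1 z.2).1⟩, ⟨l z / α 0 z, ((hM z).1 z.2).2⟩)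
      invFun := fun w ↦ ⟨(w.1 : ℂ) • (e + (w.2 : ℂ) • k), (hM _).2 (by
        rw [(hM' _ _).1, (hM' _ _).2, mul_div_cancel_left₀ _ w.1.2]
        exact ⟨w.1.2, w.2.2⟩)⟩
      left_inv := fun z ↦ Subtype.ext (by
        have := ((hM z).1 z.2).1
        change α 0 z • (e + (l z / α 0 z) • k) = z
        rw [smul_add, smul_smul, mul_div_cancel₀ _ this, hz])
      right_inv := fun w ↦ Prod.ext (Subtype.ext (hM' _ _).1) (Subtype.ext (by
        change l _ / α 0 _ = _
        rw [(hM' _ _).1, (hM' _ _).2, mul_div_cancel_left₀ _ w.1.2]))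
      continuous_toFun := by
        refine .prodMk (.subtype_mk (by fun_prop) _) (.subtype_mk ?_ _)
        exact (hcl.comp continuous_subtype_val).div (hc0.comp continuous_subtype_val)
          fun z ↦ ((hM z).1 z.2).1
      continuous_invFun := by fun_prop }

end Arrangement

/-- For `n ≥ 1` pairwise linearly independent nonzero linear forms on
`ℂ²` (so `M` is the complement of `n` distinct lines through the origin in `ℂ²`), the
Betti numbers of `M` are `b₀ = 1`, `b₁ = n` and `b₂ = n − 1`; that is, the Poincaré
polynomial of `M` is `(1 + t)(1 + (n−1)t)`. -/
theorem betti_numbers_of_two_arrangement_complement {n : ℕ} (hn : 1 ≤ n)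
    (α : Fin n → ((Fin 2 → ℂ) →ₗ[ℂ] ℂ)) (hα : ∀ i, α i ≠ 0)
    (hind : ∀ i j, i ≠ j → ∀ c : ℂ, α i ≠ c • α j) :
    bettiNumber (TopCat.of {z : Fin 2 → ℂ // (∏ i, α i z) ≠ 0}) 0 = 1 ∧
    bettiNumber (TopCat.of {z : Fin 2 → ℂ // (∏ i, α i z) ≠ 0}) 1 = n ∧
    bettiNumber (TopCat.of {z : Fin 2 → ℂ // (∏ i, α i z) ≠ 0}) 2 = (n - 1 : ℕ) := by
  obtain ⟨m, rfl⟩ := Nat.exists_eq_add_of_le' hn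
  obtain ⟨Q, hQ, ⟨e⟩⟩ := exists_homeomorph_arrangement_complement (hα 0) hind
  obtain ⟨A, hA, ⟨e'⟩⟩ := Complex.exists_compl_homeomorph_puncturedPlane Q
  have h (p : ℕ) := bettiNumber_eq_of_homeomorph (e.trans ((Homeomorph.refl _).prodCongr e')) p
  have h' := bettiNumber_prod_puncturedPlane A Complex.bettiNumber_ne_zero
  rw [hA, hQ] at h'
  refine ⟨(h 0).trans (h'.1.trans (by simp)), (h 1).trans ((h'.2 0).trans (by simp)),
    (h 2).trans ((h'.2 1).trans (by simp))⟩
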